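/- arXiv:1608.02265 — 7 statements merged into one kernel-verified Lean document; each statement's English description precedes it below -/
import Mathlib

section
/- Let H, G, U, V be complex Hilbert spaces, let P = [P₁₁ P₁₂; P₂₁ P₂₂] and Q = [Q₁₁ Q₁₂; Q₂₁ Q₂₂] be bounded operators from H⊕U to G⊕V, and let X, Y : V → U be bounded operators such that I − P₂₂X and I − Q₂₂Y are invertible. Then I − ℱ_Q(Y)*ℱ_P(X) = Q₂₁*(I − Y*Q₂₂*)⁻¹(I − Y*X)(I − P₂₂X)⁻¹P₂₁ + [I, Q₂₁*(I − Y*Q₂₂*)⁻¹Y*]·(I − Q*P)·[I; X(I − P₂₂X)⁻¹P₂₁], as bounded operators on H. -/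
open ContinuousLinearMap

noncomputable section

variable {H U G V : Type*}
  [NormedAddCommGroup H] [InnerProductSpace ℂ H] [CompleteSpace H]
  [NormedAddCommGroup U] [InnerProductSpace ℂ U] [CompleteSpace U]
  [NormedAddCommGroup G] [InnerProductSpace ℂ G] [CompleteSpace G]
  [NormedAddCommGroup V] [InnerProductSpace ℂ V] [CompleteSpace V]

/-- An operator `P : H ⊕ U → G ⊕ V` (Hilbert space direct sums), viewed as a map of
the underlying products. -/
def asProdMap (P : WithLp 2 (H × U) →L[ℂ] WithLp 2 (G × V)) : (H × U) →L[ℂ] (G × V) :=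
  (((WithLp.prodContinuousLinearEquiv 2 ℂ G V).toContinuousLinearMap.comp P).comp
    (WithLp.prodContinuousLinearEquiv 2 ℂ H U).symm.toContinuousLinearMap)

/-- The block P₁₁ : H → G of a block operator P : H ⊕ U → G ⊕ V. -/
def blk11 (P : WithLp 2 (H × U) →L[ℂ] WithLp 2 (G × V)) : H →L[ℂ] G :=
  ((fst ℂ G V).comp (asProdMap P)).comp (inl ℂ H U)

/-- The block P₁₂ : U → G of a block operator P : H ⊕ U → G ⊕ V. -/
def blk12 (P : WithLp 2 (H × U) →L[ℂ] WithLp 2 (G × V)) : U →L[ℂ] G :=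
  ((fst ℂ G V).comp (asProdMap P)).comp (inr ℂ H U)

/-- The block P₂₁ : H → V of a block operator P : H ⊕ U → G ⊕ V. -/
def blk21 (P : WithLp 2 (H × U) →L[ℂ] WithLp 2 (G × V)) : H →L[ℂ] V :=
  ((snd ℂ G V).comp (asProdMap P)).comp (inl ℂ H U)

/-- The block P₂₂ : U → V of a block operator P : H ⊕ U → G ⊕ V. -/
def blk22 (P : WithLp 2 (H × U) →L[ℂ] WithLp 2 (G × V)) : U →L[ℂ] V :=
  ((snd ℂ G V).comp (asProdMap P)).comp (inr ℂ H U)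

/-- The linear fractional transformation
`ℱ_P(X) = P₁₁ + P₁₂ X (I − P₂₂ X)⁻¹ P₂₁ : H → G`. -/
def lftOp (P : WithLp 2 (H × U) →L[ℂ] WithLp 2 (G × V)) (X : V →L[ℂ] U) :
    H →L[ℂ] G :=
  blk11 P + ((blk12 P).comp X).comp ((Ring.inverse (1 - (blk22 P).comp X)).comp (blk21 P))

set_option linter.unusedSectionVars false in
/-- With `v = (I − P₂₂ X)⁻¹ P₂₁ h`, the operator `P` maps `(h, X v)` to `(ℱ_P(X) h, v)`. -/
lemma apply_toLp_eq_lftOp (P : WithLp 2 (H × U) →L[ℂ] WithLp 2 (G × V)) (X : V →L[ℂ] U)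
    (hP : IsUnit (1 - (blk22 P).comp X)) (h : H) :
    P (WithLp.toLp 2 (h, X (Ring.inverse (1 - (blk22 P).comp X) (blk21 P h)))) =
      WithLp.toLp 2 (lftOp P X h, Ring.inverse (1 - (blk22 P).comp X) (blk21 P h)) := by
  have hfix := DFunLike.congr_fun (Ring.mul_inverse_cancel _ hP) (blk21 P h)
  simp only [mul_apply_eq_comp, sub_apply, one_apply_eq_self, comp_apply] at hfix
  rw [sub_eq_iff_eq_add] at hfix
  set v := Ring.inverse (1 - (blk22 P).comp X) (blk21 P h) with hv
  have hsplit : WithLp.toLp 2 (h, X v) =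
      WithLp.toLp 2 (h, (0 : U)) + WithLp.toLp 2 ((0 : H), X v) := by
    rw [← WithLp.toLp_add]
    simp
  refine (WithLp.prodContinuousLinearEquiv 2 ℂ G V).injective (Prod.ext ?_ ?_)
  · simp [hsplit, lftOp, blk11, blk12, asProdMap, ← hv]
  · refine Eq.trans ?_ hfix.symm
    simp [hsplit, blk21, blk22, asProdMap]

/-- The inverse of `I − X* A*` is the adjoint of the inverse of `I − A X`. -/
lemma inverse_one_sub_adjoint_comp (A : U →L[ℂ] V) (X : V →L[ℂ] U) :
    Ring.inverse (1 - (adjoint X).comp (adjoint A)) =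
      adjoint (Ring.inverse (1 - A.comp X)) := by
  rw [← adjoint_comp, ← star_eq_adjoint, ← star_eq_adjoint, ← Ring.inverse_star, star_sub, star_one]

/-- Proposition 4.1: the fundamental identity
`I − ℱ_Q(Y)*ℱ_P(X) = Q₂₁*(I − Y*Q₂₂*)⁻¹(I − Y*X)(I − P₂₂X)⁻¹P₂₁
  + [I, Q₂₁*(I − Y*Q₂₂*)⁻¹Y*] (I − Q*P) [I; X(I − P₂₂X)⁻¹P₂₁]`
as bounded operators on H. -/
theorem lftOp_identity
    (P Q : WithLp 2 (H × U) →L[ℂ] WithLp 2 (G × V)) (X Y : V →L[ℂ] U)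
    (hPinv : IsUnit (1 - (blk22 P).comp X)) (hQinv : IsUnit (1 - (blk22 Q).comp Y)) :
    1 - (adjoint (lftOp Q Y)).comp (lftOp P X) =
      (adjoint (blk21 Q)).comp
        ((Ring.inverse (1 - (adjoint Y).comp (adjoint (blk22 Q)))).comp
          ((1 - (adjoint Y).comp X).comp
            ((Ring.inverse (1 - (blk22 P).comp X)).comp (blk21 P)))) +
      ((((ContinuousLinearMap.id ℂ H).coprod
            ((adjoint (blk21 Q)).comp
              ((Ring.inverse (1 - (adjoint Y).comp (adjoint (blk22 Q)))).comp
                (adjoint Y)))).comp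
          (WithLp.prodContinuousLinearEquiv 2 ℂ H U).toContinuousLinearMap).comp
        ((1 - (adjoint Q).comp P).comp
          ((WithLp.prodContinuousLinearEquiv 2 ℂ H U).symm.toContinuousLinearMap.comp
            ((ContinuousLinearMap.id ℂ H).prod
              (X.comp ((Ring.inverse (1 - (blk22 P).comp X)).comp (blk21 P))))))) := by
  refine ContinuousLinearMap.ext fun h => ext_inner_left ℂ fun k => ?_
  have hP := apply_toLp_eq_lftOp P X hPinv h
  have hQ := apply_toLp_eq_lftOp Q Y hQinv k
  rw [inverse_one_sub_adjoint_comp]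
  simp only [comp_apply, add_apply, sub_apply, one_apply_eq_self, coprod_apply, prod_apply,
    id_apply, ContinuousLinearEquiv.coe_coe, WithLp.prodContinuousLinearEquiv_apply,
    WithLp.prodContinuousLinearEquiv_symm_apply, inner_add_right, inner_sub_right,
    adjoint_inner_right]
  set v := Ring.inverse (1 - (blk22 P).comp X) (blk21 P h)
  set w := Ring.inverse (1 - (blk22 Q).comp Y) (blk21 Q k)
  have hrow (z : WithLp 2 (H × U)) :
      inner ℂ k z.fst + inner ℂ (Y w) z.snd = inner ℂ (WithLp.toLp 2 (k, Y w)) z := by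
    simp [WithLp.prod_inner_apply]
  have key := hrow (WithLp.toLp 2 (h, X v) - adjoint Q (P (WithLp.toLp 2 (h, X v))))
  rw [inner_sub_right, adjoint_inner_right, hP, hQ] at key
  simp [WithLp.prod_inner_apply, inner_sub_right, hP] at key ⊢
  linear_combination -key

end
end

section
/- Let H, G, U, V be complex Hilbert spaces, let P = [P₁₁ P₁₂; P₂₁ P₂₂] : H⊕U → G⊕V be a bounded operator, and let X : V → U be a bounded operator such that I − P₂₂X is invertible. If ‖X‖ ≤ 1 and ‖P‖ ≤ 1, then ‖ℱ_P(X)‖ ≤ 1. -/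
open ContinuousLinearMap

noncomputable section

variable {H U G V : Type*}
  [NormedAddCommGroup H] [InnerProductSpace ℂ H] [CompleteSpace H]
  [NormedAddCommGroup U] [InnerProductSpace ℂ U] [CompleteSpace U]
  [NormedAddCommGroup G] [InnerProductSpace ℂ G] [CompleteSpace G]
  [NormedAddCommGroup V] [InnerProductSpace ℂ V] [CompleteSpace V]

omit [CompleteSpace H] [CompleteSpace U] [CompleteSpace G] [CompleteSpace V] in
theorem apply_toLp_prod (P : WithLp 2 (H × U) →L[ℂ] WithLp 2 (G × V)) (h : H) (u : U) :
    P (WithLp.toLp 2 (h, u)) =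
      WithLp.toLp 2 (blk11 P h + blk12 P u, blk21 P h + blk22 P u) := by
  have hsum : WithLp.toLp 2 (h, u) =
      (WithLp.toLp 2 (h, 0) + WithLp.toLp 2 (0, u) : WithLp 2 (H × U)) := by
    rw [← WithLp.toLp_add]; simp
  rw [hsum, map_add]
  rfl

omit [CompleteSpace H] [CompleteSpace U] [CompleteSpace G] [CompleteSpace V] in
/-- The closed-loop identity: feeding `X v` back into `P`, where `v = (I − P₂₂X)⁻¹P₂₁h`,
reproduces `v` as the second output and yields `ℱ_P(X) h` as the first. -/
theorem apply_toLp_feedback (P : WithLp 2 (H × U) →L[ℂ] WithLp 2 (G × V))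
    (X : V →L[ℂ] U) (hinv : IsUnit (1 - (blk22 P).comp X)) (h : H) :
    P (WithLp.toLp 2 (h, X (Ring.inverse (1 - (blk22 P).comp X) (blk21 P h)))) =
      WithLp.toLp 2 (lftOp P X h, Ring.inverse (1 - (blk22 P).comp X) (blk21 P h)) := by
  have hv := DFunLike.congr_fun (Ring.mul_inverse_cancel _ hinv) (blk21 P h)
  rw [mul_apply_eq_comp, sub_apply,
    one_apply_eq_self, one_apply_eq_self, comp_apply,
    sub_eq_iff_eq_add] at hv
  rw [apply_toLp_prod, ← hv]
  rfl

/-- Proposition 4.2: if `‖X‖ ≤ 1`, `‖P‖ ≤ 1` and `I − P₂₂X` is invertible then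
`‖ℱ_P(X)‖ ≤ 1`. -/
theorem norm_lftOp_le_one (P : WithLp 2 (H × U) →L[ℂ] WithLp 2 (G × V))
    (X : V →L[ℂ] U) (hinv : IsUnit (1 - (blk22 P).comp X))
    (hX : ‖X‖ ≤ 1) (hP : ‖P‖ ≤ 1) :
    ‖lftOp P X‖ ≤ 1 := by
  refine ContinuousLinearMap.opNorm_le_bound _ zero_le_one fun h => ?_
  have hle := P.le_of_opNorm_le hP
    (WithLp.toLp 2 (h, X (Ring.inverse (1 - (blk22 P).comp X) (blk21 P h))))
  have hXv := X.le_of_opNorm_le hX (Ring.inverse (1 - (blk22 P).comp X) (blk21 P h))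
  rw [apply_toLp_feedback P X hinv h, one_mul] at hle
  rw [one_mul] at hXv ⊢
  have hsq := pow_le_pow_left₀ (norm_nonneg _) hle 2
  rw [WithLp.prod_norm_sq_eq_of_L2, WithLp.prod_norm_sq_eq_of_L2] at hsq
  have hXsq := pow_le_pow_left₀ (norm_nonneg _) hXv 2
  refine (sq_le_sq₀ (norm_nonneg _) (norm_nonneg _)).1 ?_
  simp only [WithLp.toLp_fst, WithLp.toLp_snd] at hsq
  linarith

end
end

section
/- Let (N,M) ∈ ℛ₁₁. Then there exist functions f, g : 𝔻² → ℂ such that N(z,λ,w,μ) = conj(f(w,μ))·f(z,λ) and K_{N,M}(z,λ,w,μ) = conj(g(w,μ))·g(z,λ) for all z,λ,w,μ ∈ 𝔻, and a function Ξ ∈ 𝒮^{2×2} such that Ξ(λ)·(1, z f(z,λ))ᵀ = (g(z,λ), f(z,λ))ᵀ for all z, λ ∈ 𝔻. -/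
open Complex Matrix Metric
open scoped ComplexOrder

noncomputable section

/-- The open unit disc in ℂ. -/
def uDisc : Set ℂ := Metric.ball 0 1

/-- The operator (ℓ²) norm of a 2×2 complex matrix. -/
noncomputable def matNorm (A : Matrix (Fin 2) (Fin 2) ℂ) : ℝ :=
  ‖Matrix.toEuclideanCLM (𝕜 := ℂ) A‖

/-- The 2×2 matricial Schur class of the disc: analytic, with `‖F(λ)‖ ≤ 1` on 𝔻. -/
def Schur2x2 (F : ℂ → Matrix (Fin 2) (Fin 2) ℂ) : Prop :=
  (∀ i j, AnalyticOnNhd ℂ (fun l => F l i j) uDisc) ∧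
    ∀ l ∈ uDisc, matNorm (F l) ≤ 1

/-- A (positive semidefinite) kernel on 𝔻²: `k z λ w μ` stands for `k(z,λ,w,μ)`. -/
def IsKernel (k : ℂ → ℂ → ℂ → ℂ → ℂ) : Prop :=
  ∀ (m : ℕ) (z lam c : Fin m → ℂ), (∀ i, z i ∈ uDisc) → (∀ i, lam i ∈ uDisc) →
    0 ≤ ∑ i, ∑ j, star (c i) * c j * k (z j) (lam j) (z i) (lam i)

/-- An analytic kernel on 𝔻²: a kernel analytic in (z,λ) for each fixed (w,μ) ∈ 𝔻². -/
def IsAnalyticKernel (k : ℂ → ℂ → ℂ → ℂ → ℂ) : Prop :=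
  IsKernel k ∧ ∀ w ∈ uDisc, ∀ μ ∈ uDisc,
    AnalyticOnNhd ℂ (fun p : ℂ × ℂ => k p.1 p.2 w μ) (uDisc ×ˢ uDisc)

/-- A kernel has rank 1 if it factors as `conj (f(w,μ)) * f(z,λ)` with `f` not
identically zero on 𝔻². -/
def HasRankOne (k : ℂ → ℂ → ℂ → ℂ → ℂ) : Prop :=
  ∃ f : ℂ → ℂ → ℂ, (∃ z ∈ uDisc, ∃ lam ∈ uDisc, f z lam ≠ 0) ∧
    ∀ z ∈ uDisc, ∀ lam ∈ uDisc, ∀ w ∈ uDisc, ∀ μ ∈ uDisc,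
      k z lam w μ = star (f w μ) * f z lam

/-- K_{N,M}(z,λ,w,μ) = 1 − (1 − conj w · z) N(z,λ,w,μ) − (1 − conj μ · λ) M(z,λ,w,μ). -/
def Kker (N M : ℂ → ℂ → ℂ → ℂ → ℂ) (z lam w μ : ℂ) : ℂ :=
  1 - (1 - star w * z) * N z lam w μ - (1 - star μ * lam) * M z lam w μ

/-- The set ℛ₁: pairs (N,M) of analytic kernels on 𝔻² such that K_{N,M} is an
analytic kernel of rank 1. -/
def memR1 (N M : ℂ → ℂ → ℂ → ℂ → ℂ) : Prop :=
  IsAnalyticKernel N ∧ IsAnalyticKernel M ∧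
    IsAnalyticKernel (Kker N M) ∧ HasRankOne (Kker N M)

/-- The set ℛ₁₁: pairs (N,M) ∈ ℛ₁ such that N also has rank 1. -/
def memR11 (N M : ℂ → ℂ → ℂ → ℂ → ℂ) : Prop :=
  memR1 N M ∧ HasRankOne N

/-- γ_F(λ,z) = (1 − F₂₂(λ)z)⁻¹ F₂₁(λ). -/
def gam (F : ℂ → Matrix (Fin 2) (Fin 2) ℂ) (l z : ℂ) : ℂ :=
  (1 - F l 1 1 * z)⁻¹ * F l 1 0

/-- η_F(λ,z) = (1, z γ_F(λ,z))ᵀ. -/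
def eta (F : ℂ → Matrix (Fin 2) (Fin 2) ℂ) (l z : ℂ) : Fin 2 → ℂ :=
  ![1, z * gam F l z]

/-- N_F(z,λ,w,μ) = conj(γ_F(μ,w)) γ_F(λ,z). -/
def NF (F : ℂ → Matrix (Fin 2) (Fin 2) ℂ) (z lam w μ : ℂ) : ℂ :=
  star (gam F μ w) * gam F lam z

/-- M_F(z,λ,w,μ) = η_F(μ,w)* [(I − F(μ)*F(λ))/(1 − conj μ · λ)] η_F(λ,z). -/
def MF (F : ℂ → Matrix (Fin 2) (Fin 2) ℂ) (z lam w μ : ℂ) : ℂ :=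
  (1 - star μ * lam)⁻¹ *
    (star (eta F μ w) ⬝ᵥ ((1 - (F μ)ᴴ * F lam) *ᵥ eta F lam z))

end

section

lemma isOpen_uDisc : IsOpen uDisc := Metric.isOpen_ball

lemma isPreconnected_uDisc : IsPreconnected uDisc :=
  (convex_ball (0 : ℂ) 1).isPreconnected

lemma one_sub_star_mul_self_pos {l : ℂ} (hl : l ∈ uDisc) : 0 < 1 - star l * l := by
  have h1 : ‖l‖ < 1 := by simpa [uDisc] using hl
  have h2 : 1 - star l * l = ((1 - ‖l‖ ^ 2 : ℝ) : ℂ) := by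
    have := Complex.conj_mul' l
    rw [Complex.star_def, this]; push_cast; rfl
  rw [h2]
  have : ‖l‖ ^ 2 < 1 := by nlinarith [norm_nonneg l]
  exact_mod_cast sub_pos.mpr this

/-- A function bounded by an analytic function which does not vanish identically is divisible
by it. -/
lemma exists_analyticOnNhd_mul_eq {U : Set ℂ} (hU : IsOpen U) (hc : IsPreconnected U)
    {p q : ℂ → ℂ} (hp : AnalyticOnNhd ℂ p U) (hq : AnalyticOnNhd ℂ q U)
    (hpq : ∀ l ∈ U, ‖p l‖ ≤ ‖q l‖) (hne : ∃ l ∈ U, q l ≠ 0) :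
    ∃ b : ℂ → ℂ, AnalyticOnNhd ℂ b U ∧ ∀ l ∈ U, b l * q l = p l := by
  have hq0 : ∀ l ∈ U, ∀ᶠ x in nhdsWithin l {l}ᶜ, q x ≠ 0 := by
    intro l hl
    rcases (hq l hl).eventually_eq_zero_or_eventually_ne_zero with h | h
    · obtain ⟨m, hm, hm0⟩ := hne
      exact absurd (hq.eqOn_zero_of_preconnected_of_eventuallyEq_zero hc hl h hm) hm0
    · exact h
  have hval : ∀ l ∈ U, q l ≠ 0 →
      Filter.limUnder (nhdsWithin l {l}ᶜ) (fun x => p x / q x) = p l / q l := by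
    intro l hl h
    apply Filter.Tendsto.limUnder_eq
    exact (((hp l hl).continuousAt.div (hq l hl).continuousAt h).tendsto).mono_left
      nhdsWithin_le_nhds
  refine ⟨fun l => Filter.limUnder (nhdsWithin l {l}ᶜ) (fun x => p x / q x), ?_, ?_⟩
  · intro l hl
    obtain ⟨s, hs, hsU⟩ : ∃ s ∈ nhds l, ∀ x ∈ s, x ∈ U ∧ (x ≠ l → q x ≠ 0) := by
      have := (hU.eventually_mem hl).and (eventually_nhdsWithin_iff.mp (hq0 l hl))
      exact ⟨_, this, fun x hx => ⟨hx.1, fun h => hx.2 h⟩⟩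
    have hd : DifferentiableOn ℂ (Function.update (fun x => p x / q x) l
        (Filter.limUnder (nhdsWithin l {l}ᶜ) (fun x => p x / q x))) s := by
      apply Complex.differentiableOn_update_limUnder_of_bddAbove hs
      · intro x hx
        have hx' := hsU x hx.1
        exact ((hp x hx'.1).differentiableAt.div (hq x hx'.1).differentiableAt
          (hx'.2 hx.2)).differentiableWithinAt
      · refine ⟨1, ?_⟩
        rintro _ ⟨x, hx, rfl⟩
        have hx' := hsU x hx.1
        simp only [Function.comp, norm_div]
        exact div_le_one_of_le₀ (hpq x hx'.1) (norm_nonneg _)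
    refine (hd.analyticAt hs).congr ?_
    filter_upwards [hs] with x hx
    by_cases hxl : x = l
    · subst hxl; simp
    · rw [Function.update_of_ne hxl]
      exact (hval x (hsU x hx).1 ((hsU x hx).2 hxl)).symm
  · intro l hl
    by_cases h : q l = 0
    · have : p l = 0 := by simpa [h] using hpq l hl
      rw [h, this, mul_zero]
    · simp only [hval l hl h]
      field_simp

lemma matNorm_le_one {A : Matrix (Fin 2) (Fin 2) ℂ}
    (h : ∀ x y : ℂ, ‖A 0 0 * x + A 0 1 * y‖ ^ 2 + ‖A 1 0 * x + A 1 1 * y‖ ^ 2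
      ≤ ‖x‖ ^ 2 + ‖y‖ ^ 2) : matNorm A ≤ 1 := by
  refine ContinuousLinearMap.opNorm_le_bound _ zero_le_one fun x => ?_
  rw [one_mul, EuclideanSpace.norm_eq, EuclideanSpace.norm_eq]
  apply Real.sqrt_le_sqrt
  simpa [Fin.sum_univ_two, Matrix.mulVec, dotProduct] using h (x 0) (x 1)

lemma HasRankOne.analyticOnNhd {k : ℂ → ℂ → ℂ → ℂ → ℂ} {f : ℂ → ℂ → ℂ} (hk : IsAnalyticKernel k)
    (hne : ∃ z ∈ uDisc, ∃ lam ∈ uDisc, f z lam ≠ 0)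
    (hf : ∀ z ∈ uDisc, ∀ lam ∈ uDisc, ∀ w ∈ uDisc, ∀ μ ∈ uDisc,
      k z lam w μ = star (f w μ) * f z lam) :
    AnalyticOnNhd ℂ (fun p : ℂ × ℂ => f p.1 p.2) (uDisc ×ˢ uDisc) := by
  obtain ⟨w, hw, μ, hμ, h0⟩ := hne
  have h1 : AnalyticOnNhd ℂ (fun p : ℂ × ℂ => (star (f w μ))⁻¹ * k p.1 p.2 w μ)
      (uDisc ×ˢ uDisc) := fun p hp => analyticAt_const.mul (hk.2 w hw μ hμ p hp)
  refine h1.congr (isOpen_uDisc.prod isOpen_uDisc) ?_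
  rintro ⟨z, l⟩ ⟨hz, hl⟩
  have : star (f w μ) ≠ 0 := by simpa using h0
  simp only [hf z hz l hl w hw μ hμ]
  field_simp

/-- The vectors `(g, f)` are the images of the vectors `(1, z f)` under a contraction, for
each fixed `λ`. -/
lemma gram_le {N M : ℂ → ℂ → ℂ → ℂ → ℂ} {f g : ℂ → ℂ → ℂ} (hM : IsKernel M)
    (hf : ∀ z ∈ uDisc, ∀ lam ∈ uDisc, ∀ w ∈ uDisc, ∀ μ ∈ uDisc,
      N z lam w μ = star (f w μ) * f z lam)
    (hg : ∀ z ∈ uDisc, ∀ lam ∈ uDisc, ∀ w ∈ uDisc, ∀ μ ∈ uDisc,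
      Kker N M z lam w μ = star (g w μ) * g z lam)
    {l : ℂ} (hl : l ∈ uDisc) {m : ℕ} (z c : Fin m → ℂ) (hz : ∀ i, z i ∈ uDisc) :
    ‖∑ i, c i * g (z i) l‖ ^ 2 + ‖∑ i, c i * f (z i) l‖ ^ 2
      ≤ ‖∑ i, c i‖ ^ 2 + ‖∑ i, c i * (z i * f (z i) l)‖ ^ 2 := by
  have h1 := mul_nonneg (one_sub_star_mul_self_pos hl).le
    (hM m z (fun _ => l) c hz (fun _ => hl))
  have h2 : ∀ a : Fin m → ℂ, ∑ i, ∑ j, star (a i) * a j = ((‖∑ i, a i‖ ^ 2 : ℝ) : ℂ) := by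
    intro a
    have := Complex.conj_mul' (∑ i, a i)
    push_cast
    rw [← this, map_sum, Finset.sum_mul_sum]
    rfl
  have h3 : (1 - star l * l) * ∑ i, ∑ j, star (c i) * c j * M (z j) l (z i) l
      = ((‖∑ i, c i‖ ^ 2 + ‖∑ i, c i * (z i * f (z i) l)‖ ^ 2
        - ‖∑ i, c i * g (z i) l‖ ^ 2 - ‖∑ i, c i * f (z i) l‖ ^ 2 : ℝ) : ℂ) := by
    rw [Complex.ofReal_sub, Complex.ofReal_sub, Complex.ofReal_add, ← h2, ← h2, ← h2, ← h2]
    simp only [Finset.mul_sum, ← Finset.sum_add_distrib, ← Finset.sum_sub_distrib]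
    refine Finset.sum_congr rfl fun i _ => Finset.sum_congr rfl fun j _ => ?_
    have e1 := hg _ (hz j) l hl _ (hz i) l hl
    have e2 := hf _ (hz j) l hl _ (hz i) l hl
    rw [Kker, e2] at e1
    simp only [star_mul']
    linear_combination (-star (c i) * c j) * e1
  rw [h3] at h1
  have h4 := Complex.zero_le_real.mp h1
  linarith

/-- Theorem 5.5 (Procedure UW): given `(N,M) ∈ ℛ₁₁` there are factorizations
`N = conj(f(w,μ)) f(z,λ)`, `K_{N,M} = conj(g(w,μ)) g(z,λ)` and a function
`Ξ ∈ 𝒮^{2×2}` with `Ξ(λ)(1, z f(z,λ))ᵀ = (g(z,λ), f(z,λ))ᵀ` on 𝔻². -/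
theorem procedure_UW (N M : ℂ → ℂ → ℂ → ℂ → ℂ) (hNM : memR11 N M) :
    ∃ f g : ℂ → ℂ → ℂ, ∃ Xi : ℂ → Matrix (Fin 2) (Fin 2) ℂ,
      Schur2x2 Xi ∧
      (∀ z ∈ uDisc, ∀ lam ∈ uDisc, ∀ w ∈ uDisc, ∀ μ ∈ uDisc,
        N z lam w μ = star (f w μ) * f z lam ∧
        Kker N M z lam w μ = star (g w μ) * g z lam) ∧
      (∀ z ∈ uDisc, ∀ lam ∈ uDisc,
        (Xi lam) *ᵥ ![1, z * f z lam] = ![g z lam, f z lam]) := by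
  obtain ⟨⟨hN, hM, hK, g, hg0, hg⟩, f, hf0, hf⟩ := hNM
  have hfa := HasRankOne.analyticOnNhd hN hf0 hf
  have hga := HasRankOne.analyticOnNhd hK hg0 hg
  have slice : ∀ {h : ℂ → ℂ → ℂ},
      AnalyticOnNhd ℂ (fun p : ℂ × ℂ => h p.1 p.2) (uDisc ×ˢ uDisc) →
      ∀ z ∈ uDisc, AnalyticOnNhd ℂ (fun l => h z l) uDisc := by
    intro h hh z hz l hl
    exact (hh (z, l) ⟨hz, hl⟩).comp₂ analyticAt_const analyticAt_id
  have zero_mem : (0 : ℂ) ∈ uDisc := by simp [uDisc]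
  have gram : ∀ l ∈ uDisc, ∀ {m : ℕ} (z c : Fin m → ℂ), (∀ i, z i ∈ uDisc) →
      ‖∑ i, c i * g (z i) l‖ ^ 2 + ‖∑ i, c i * f (z i) l‖ ^ 2
        ≤ ‖∑ i, c i‖ ^ 2 + ‖∑ i, c i * (z i * f (z i) l)‖ ^ 2 :=
    fun l hl _ z c hz => gram_le hM.1 hf hg hl z c hz
  obtain ⟨z₀, hz₀, hz₀0, l₁, hl₁, hf₁⟩ :
      ∃ z₀ ∈ uDisc, z₀ ≠ 0 ∧ ∃ l₁ ∈ uDisc, f z₀ l₁ ≠ 0 := by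
    obtain ⟨z, hz, l, hl, h⟩ := hf0
    by_cases hz0 : z = 0
    · have hcont : ContinuousAt (fun z => f z l) z :=
        ((hfa (z, l) ⟨hz, hl⟩).comp₂ analyticAt_id analyticAt_const).continuousAt
      have hev := ((hcont.eventually_ne h).and (isOpen_uDisc.eventually_mem hz)).filter_mono
        (nhdsWithin_le_nhds (s := {z}ᶜ))
      obtain ⟨x, ⟨hx1, hx2⟩, hx3⟩ := (hev.and self_mem_nhdsWithin).exists
      exact ⟨x, hx2, by simpa [hz0] using hx3, l, hl, hx1⟩
    · exact ⟨z, hz, hz0, l, hl, h⟩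
  have hqa : AnalyticOnNhd ℂ (fun l => z₀ * f z₀ l) uDisc :=
    fun l hl => analyticAt_const.mul (slice hfa z₀ hz₀ l hl)
  have hq1 : ∃ l ∈ uDisc, z₀ * f z₀ l ≠ 0 := ⟨l₁, hl₁, mul_ne_zero hz₀0 hf₁⟩
  have hdiff : ∀ l ∈ uDisc, ‖g z₀ l - g 0 l‖ ^ 2 + ‖f z₀ l - f 0 l‖ ^ 2
      ≤ ‖z₀ * f z₀ l‖ ^ 2 := by
    intro l hl
    have := gram l hl ![z₀, 0] ![1, -1] (by simp [Fin.forall_fin_two, hz₀, zero_mem])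
    simpa [Fin.sum_univ_two, ← sub_eq_add_neg] using this
  obtain ⟨b, hba, hb⟩ := exists_analyticOnNhd_mul_eq isOpen_uDisc isPreconnected_uDisc
    (p := fun l => g z₀ l - g 0 l)
    (fun l hl => (slice hga z₀ hz₀ l hl).sub (slice hga 0 zero_mem l hl)) hqa
    (fun l hl => (sq_le_sq₀ (norm_nonneg _) (norm_nonneg _)).mp
      (by nlinarith [hdiff l hl, sq_nonneg ‖f z₀ l - f 0 l‖])) hq1
  obtain ⟨d, hda, hd⟩ := exists_analyticOnNhd_mul_eq isOpen_uDisc isPreconnected_uDisc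
    (p := fun l => f z₀ l - f 0 l)
    (fun l hl => (slice hfa z₀ hz₀ l hl).sub (slice hfa 0 zero_mem l hl)) hqa
    (fun l hl => (sq_le_sq₀ (norm_nonneg _) (norm_nonneg _)).mp
      (by nlinarith [hdiff l hl, sq_nonneg ‖g z₀ l - g 0 l‖])) hq1
  have hg0a := slice hga 0 zero_mem
  have hf0a := slice hfa 0 zero_mem
  have hdense : ∀ l ∈ uDisc, ∃ᶠ x in nhds l, x ∈ uDisc ∧ z₀ * f z₀ x ≠ 0 := by
    intro l hl hcon
    obtain ⟨m, hm, hm0⟩ := hq1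
    refine hm0 (hqa.eqOn_zero_of_preconnected_of_eventuallyEq_zero isPreconnected_uDisc hl ?_ hm)
    filter_upwards [hcon, isOpen_uDisc.eventually_mem hl] with x hx hxU
    by_contra h
    exact hx ⟨hxU, h⟩
  refine ⟨f, g, fun l => !![g 0 l, b l; f 0 l, d l], ⟨?_, ?_⟩,
    fun z hz l hl w hw μ hμ => ⟨hf z hz l hl w hw μ hμ, hg z hz l hl w hw μ hμ⟩, ?_⟩
  · intro i j
    fin_cases i <;> fin_cases j <;> simpa
  · intro l hl
    apply matNorm_le_one
    intro x y
    simp only [Matrix.of_apply, Matrix.cons_val', Matrix.cons_val_zero, Matrix.cons_val_one,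
      Matrix.cons_val_fin_one]
    by_contra hcon
    rw [not_le] at hcon
    have hev := ContinuousAt.eventually_lt (f := fun _ : ℂ => ‖x‖ ^ 2 + ‖y‖ ^ 2)
      (g := fun l => ‖g 0 l * x + b l * y‖ ^ 2 + ‖f 0 l * x + d l * y‖ ^ 2)
      continuousAt_const
      (by
        have h1 := (hg0a l hl).continuousAt
        have h2 := (hf0a l hl).continuousAt
        have h3 := (hba l hl).continuousAt
        have h4 := (hda l hl).continuousAt
        fun_prop) hcon
    obtain ⟨m, ⟨hm, hq⟩, hlt⟩ := ((hdense l hl).and_eventually hev).exists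
    refine absurd hlt (not_lt.mpr ?_)
    set t := y / (z₀ * f z₀ m)
    have hy : t * (z₀ * f z₀ m) = y := div_mul_cancel₀ _ hq
    have hG := gram m hm ![0, z₀] ![x - t, t] (by simp [Fin.forall_fin_two, hz₀, zero_mem])
    simp only [Fin.sum_univ_two, Matrix.cons_val_zero, Matrix.cons_val_one,
      Matrix.cons_val_fin_one] at hG
    have e1 : (x - t) * g 0 m + t * g z₀ m = g 0 m * x + b m * y := by
      linear_combination b m * hy - t * hb m hm
    have e2 : (x - t) * f 0 m + t * f z₀ m = f 0 m * x + d m * y := by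
      linear_combination d m * hy - t * hd m hm
    have e3 : (x - t) * (0 * f 0 m) + t * (z₀ * f z₀ m) = y := by
      linear_combination hy
    rwa [e1, e2, e3, sub_add_cancel] at hG
  · intro z hz l hl
    have key : ∀ m ∈ uDisc, z₀ * f z₀ m ≠ 0 →
        g 0 m + b m * (z * f z m) - g z m = 0 ∧ f 0 m + d m * (z * f z m) - f z m = 0 := by
      intro m hm hq
      set t := z * f z m / (z₀ * f z₀ m)
      have hy : t * (z₀ * f z₀ m) = z * f z m := div_mul_cancel₀ _ hq
      have hG := gram m hm ![z, 0, z₀] ![-1, 1 - t, t]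
        (by simp [Fin.forall_fin_succ, hz, hz₀, zero_mem])
      simp only [Fin.sum_univ_three, Matrix.cons_val_zero, Matrix.cons_val_one,
        Matrix.cons_val] at hG
      have e1 : (-1 : ℂ) + (1 - t) + t = 0 := by ring
      have e2 : -1 * (z * f z m) + (1 - t) * (0 * f 0 m) + t * (z₀ * f z₀ m) = 0 := by
        linear_combination hy
      rw [e1, e2] at hG
      have e3 : -1 * g z m + (1 - t) * g 0 m + t * g z₀ m
          = g 0 m + b m * (z * f z m) - g z m := by
        linear_combination b m * hy - t * hb m hm
      have e4 : -1 * f z m + (1 - t) * f 0 m + t * f z₀ m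
          = f 0 m + d m * (z * f z m) - f z m := by
        linear_combination d m * hy - t * hd m hm
      rw [e3, e4] at hG
      simp only [norm_zero, ne_eq, OfNat.ofNat_ne_zero, not_false_eq_true, zero_pow,
        add_zero] at hG
      constructor <;> rw [← norm_eq_zero, ← sq_eq_zero_iff] <;>
        nlinarith [sq_nonneg ‖g 0 m + b m * (z * f z m) - g z m‖,
          sq_nonneg ‖f 0 m + d m * (z * f z m) - f z m‖]
    have ext : ∀ {h : ℂ → ℂ}, ContinuousAt h l →
        (∀ m ∈ uDisc, z₀ * f z₀ m ≠ 0 → h m = 0) → h l = 0 := by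
      intro h hh h0
      by_contra hne
      obtain ⟨m, ⟨hm, hq⟩, hlt⟩ := ((hdense l hl).and_eventually (hh.eventually_ne hne)).exists
      exact hlt (h0 m hm hq)
    have h1 := (hg0a l hl).continuousAt
    have h2 := (hf0a l hl).continuousAt
    have h3 := (hba l hl).continuousAt
    have h4 := (hda l hl).continuousAt
    have h5 := (slice hfa z hz l hl).continuousAt
    have h6 := (slice hga z hz l hl).continuousAt
    have k1 := ext (h := fun m => g 0 m + b m * (z * f z m) - g z m) (by fun_prop)
      fun m hm hq => (key m hm hq).1
    have k2 := ext (h := fun m => f 0 m + d m * (z * f z m) - f z m) (by fun_prop)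
      fun m hm hq => (key m hm hq).2
    ext i
    fin_cases i
    · simpa [Matrix.mulVec, dotProduct, Fin.sum_univ_two] using sub_eq_zero.mp k1
    · simpa [Matrix.mulVec, dotProduct, Fin.sum_univ_two] using sub_eq_zero.mp k2
end
end

section
/- Let (N,M) ∈ ℛ₁₁, let f, g : 𝔻² → ℂ satisfy N(z,λ,w,μ) = conj(f(w,μ))·f(z,λ) and K_{N,M}(z,λ,w,μ) = conj(g(w,μ))·g(z,λ) for all z,λ,w,μ ∈ 𝔻, and let Ξ ∈ 𝒮^{2×2} satisfy Ξ(λ)·(1, z f(z,λ))ᵀ = (g(z,λ), f(z,λ))ᵀ for all z, λ ∈ 𝔻. Then N_Ξ = N and M_Ξ = M on 𝔻²×𝔻². -/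
open Complex Matrix Metric
open scoped ComplexOrder

section
/-- Every entry of a matrix is bounded by its operator norm. -/
theorem norm_entry_le_matNorm (A : Matrix (Fin 2) (Fin 2) ℂ) (i j : Fin 2) :
    ‖A i j‖ ≤ matNorm A := by
  have h := (Matrix.toEuclideanCLM (𝕜 := ℂ) A).le_opNorm (EuclideanSpace.single j 1)
  have hi := PiLp.norm_apply_le
    ((Matrix.toEuclideanCLM (𝕜 := ℂ) A) (EuclideanSpace.single j 1)) i
  have he : ((Matrix.toEuclideanCLM (𝕜 := ℂ) A) (EuclideanSpace.single j 1)) i = A i j := by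
    simp [Matrix.ofLp_toEuclideanCLM]
  rw [he] at hi
  simpa [matNorm] using hi.trans h

theorem one_sub_mul_ne_zero_of_mem_uDisc {a z : ℂ} (ha : ‖a‖ ≤ 1) (hz : z ∈ uDisc) :
    1 - a * z ≠ 0 := by
  intro h
  have hz' : ‖z‖ < 1 := by simpa [uDisc] using hz
  have h1 : ‖a * z‖ = 1 := by rw [← sub_eq_zero.mp h, norm_one]
  rw [norm_mul] at h1
  nlinarith [norm_nonneg a, norm_nonneg z]

/-- A solution `x` of the second row of the model equation is the transfer value `γ_F`. -/
theorem gam_eq_of_mulVec_eq {F : ℂ → Matrix (Fin 2) (Fin 2) ℂ} (hF : Schur2x2 F)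
    {z l x y : ℂ} (hz : z ∈ uDisc) (hl : l ∈ uDisc)
    (h : F l *ᵥ ![1, z * x] = ![y, x]) : gam F l z = x := by
  have hne := one_sub_mul_ne_zero_of_mem_uDisc
    ((norm_entry_le_matNorm (F l) 1 1).trans (hF.2 l hl)) hz
  have h1 := congrFun h 1
  simp [Matrix.mulVec, dotProduct, Fin.sum_univ_two] at h1
  rw [gam, inv_mul_eq_iff_eq_mul₀ hne]
  linear_combination h1

/-- Proposition 5.10: if `Ξ ∈ UW(N,M)` then `UE(Ξ) = (N,M)`, i.e. `N_Ξ = N` and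
`M_Ξ = M` on 𝔻² × 𝔻². -/
theorem UE_UW_eq_id (N M : ℂ → ℂ → ℂ → ℂ → ℂ) (hNM : memR11 N M)
    (f g : ℂ → ℂ → ℂ)
    (hN : ∀ z ∈ uDisc, ∀ lam ∈ uDisc, ∀ w ∈ uDisc, ∀ μ ∈ uDisc,
      N z lam w μ = star (f w μ) * f z lam)
    (hK : ∀ z ∈ uDisc, ∀ lam ∈ uDisc, ∀ w ∈ uDisc, ∀ μ ∈ uDisc,
      Kker N M z lam w μ = star (g w μ) * g z lam)
    (Xi : ℂ → Matrix (Fin 2) (Fin 2) ℂ) (hXi : Schur2x2 Xi)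
    (hEq : ∀ z ∈ uDisc, ∀ lam ∈ uDisc,
      (Xi lam) *ᵥ ![1, z * f z lam] = ![g z lam, f z lam]) :
    ∀ z ∈ uDisc, ∀ lam ∈ uDisc, ∀ w ∈ uDisc, ∀ μ ∈ uDisc,
      NF Xi z lam w μ = N z lam w μ ∧ MF Xi z lam w μ = M z lam w μ := by
  intro z hz lam hlam w hw μ hμ
  have hgz := gam_eq_of_mulVec_eq hXi hz hlam (hEq z hz lam hlam)
  have hgw := gam_eq_of_mulVec_eq hXi hw hμ (hEq w hw μ hμ)
  refine ⟨by rw [NF, hgz, hgw, hN z hz lam hlam w hw μ hμ], ?_⟩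
  have hμ' : ‖star μ‖ ≤ 1 := by
    rw [norm_star]
    exact (by simpa [uDisc] using hμ : ‖μ‖ < 1).le
  have hK' := hK z hz lam hlam w hw μ hμ
  rw [Kker, hN z hz lam hlam w hw μ hμ] at hK'
  rw [MF, inv_mul_eq_iff_eq_mul₀ (one_sub_mul_ne_zero_of_mem_uDisc hμ' hlam),
    _root_.eta, _root_.eta, hgz, hgw,
    Matrix.sub_mulVec, Matrix.one_mulVec, ← Matrix.mulVec_mulVec, dotProduct_sub,
    Matrix.dotProduct_mulVec, ← Matrix.star_mulVec, hEq z hz lam hlam, hEq w hw μ hμ]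
  simp [dotProduct, Fin.sum_univ_two] at hK' ⊢
  linear_combination hK'
end
end

section
/- Let λ₁, …, λ_n be distinct points in 𝔻, let W₁, …, W_n be 2×2 complex matrices with (W_j)₁₁(W_j)₂₂ ≠ det W_j for each j, and set (x_{1j}, x_{2j}, x_{3j}) = ((W_j)₁₁, (W_j)₂₂, det W_j) for each j. The following are equivalent: (1) there exists an analytic map F : 𝔻 → M₂(ℂ) such that F(λⱼ) = Wⱼ for j = 1,…,n and μ_Diag(F(λ)) ≤ 1 for all λ ∈ 𝔻; (2) there exists a rational map x : 𝔻 → Ē (each of whose three components is a rational function with no poles in 𝔻) such that x(λⱼ) = (x_{1j}, x_{2j}, x_{3j}) for j = 1,…,n; (3) for some distinct points z₁, z₂, z₃ ∈ 𝔻 with x_{2j}z_k ≠ 1 for all j, k, there exist positive semidefinite 3n×3n complex matrices N = [N_{il,jk}] of rank at most 1 and M = [M_{il,jk}] (rows and columns indexed by pairs (i,l), (j,k) with 1 ≤ i,j ≤ n and 1 ≤ l,k ≤ 3) such that the 3n×3n matrix with ((i,l),(j,k)) entry 1 − conj((z_l x_{3i} − x_{1i})/(x_{2i}z_l − 1))·(z_k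 x_{3j} − x_{1j})/(x_{2j}z_k − 1) − (1 − conj(z_l)z_k)·N_{il,jk} − (1 − conj(λᵢ)λⱼ)·M_{il,jk} is positive semidefinite. -/
open Complex Metric Matrix
open scoped ComplexOrder ENNReal

noncomputable section

/-- The structured singular value μ_Diag(A) relative to the diagonal matrices:
`(inf {‖X‖ : X diagonal, 1 − AX singular})⁻¹`, computed in `ℝ≥0∞` so that
`inf ∅ = ∞` and hence `μ_Diag(A) = 0` when no such `X` exists. -/
noncomputable def muDiag (A : Matrix (Fin 2) (Fin 2) ℂ) : ℝ≥0∞ :=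
  (sInf {r : ℝ≥0∞ | ∃ X : Matrix (Fin 2) (Fin 2) ℂ,
    X.IsDiag ∧ (1 - A * X).det = 0 ∧ r = ENNReal.ofReal (matNorm X)})⁻¹

/-- The closed tetrablock Ē ⊂ ℂ³. -/
def closedTetra : Set (ℂ × ℂ × ℂ) :=
  {x | ∀ z ∈ uDisc, ∀ w ∈ uDisc, 1 - x.1 * z - x.2.1 * w + x.2.2 * z * w ≠ 0}

/-- A function on the disc given by a rational function with no poles in 𝔻. -/
def IsRationalOnDisc (f : ℂ → ℂ) : Prop :=
  ∃ p q : Polynomial ℂ, (∀ z ∈ uDisc, q.eval z ≠ 0) ∧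
    ∀ z ∈ uDisc, f z = p.eval z / q.eval z

lemma matNorm_diagonal (v : Fin 2 → ℂ) : matNorm (diagonal v) = ‖v‖ := by
  open scoped Matrix.Norms.L2Operator in
  exact l2_opNorm_diagonal v

lemma det_one_sub_mul_diagonal (A : Matrix (Fin 2) (Fin 2) ℂ) (v : Fin 2 → ℂ) :
    (1 - A * diagonal v).det = 1 - A 0 0 * v 0 - A 1 1 * v 1 + A.det * v 0 * v 1 := by
  simp [det_fin_two, mul_diagonal]
  ring

lemma muDiag_le_one_iff (A : Matrix (Fin 2) (Fin 2) ℂ) :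
    muDiag A ≤ 1 ↔ (A 0 0, A 1 1, A.det) ∈ closedTetra := by
  rw [muDiag, ENNReal.inv_le_one, le_sInf_iff]
  constructor
  · intro h z hz w hw h0
    have := h _ ⟨diagonal ![z, w], isDiag_diagonal _, by
      rw [det_one_sub_mul_diagonal]; simpa using h0, rfl⟩
    rw [matNorm_diagonal, ENNReal.one_le_ofReal] at this
    refine this.not_gt ((pi_norm_lt_iff one_pos).2 fun i => ?_)
    fin_cases i
    · simpa [uDisc] using hz
    · simpa [uDisc] using hw
  · rintro h r ⟨X, hX, h0, rfl⟩
    obtain ⟨v, rfl⟩ : ∃ v, X = diagonal v :=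
      ⟨X.diag, ((isDiag_iff_diagonal_diag X).1 hX).symm⟩
    rw [det_one_sub_mul_diagonal] at h0
    rw [matNorm_diagonal, ENNReal.one_le_ofReal]
    by_contra! hv
    rw [pi_norm_lt_iff one_pos] at hv
    exact h (v 0) (by simpa [uDisc] using hv 0) (v 1) (by simpa [uDisc] using hv 1) h0

lemma closedTetra_swap {x1 x2 x3 : ℂ} (h : (x1, x2, x3) ∈ closedTetra) :
    (x2, x1, x3) ∈ closedTetra := fun z hz w hw h0 =>
  h w hw z hz (by linear_combination h0)

lemma norm_snd_le_one_of_mem_closedTetra {x1 x2 x3 : ℂ} (h : (x1, x2, x3) ∈ closedTetra) :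
    ‖x2‖ ≤ 1 := by
  by_contra! h1
  have h2 : x2 ≠ 0 := norm_pos_iff.1 (one_pos.trans h1)
  refine h 0 (by simp [uDisc]) x2⁻¹ ?_ ?_
  · simpa [uDisc] using inv_lt_one_of_one_lt₀ h1
  · simp [h2]

lemma norm_fst_le_one_of_mem_closedTetra {x1 x2 x3 : ℂ} (h : (x1, x2, x3) ∈ closedTetra) :
    ‖x1‖ ≤ 1 :=
  norm_snd_le_one_of_mem_closedTetra (closedTetra_swap h)

lemma norm_sub_le_of_mem_closedTetra {x1 x2 x3 : ℂ} (h : (x1, x2, x3) ∈ closedTetra)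
    {w : ℂ} (hw : ‖w‖ ≤ 1) : ‖x1 - x3 * w‖ ≤ ‖1 - x2 * w‖ := by
  have hcl : IsClosed {w : ℂ | ‖x1 - x3 * w‖ ≤ ‖1 - x2 * w‖} :=
    isClosed_le (by fun_prop) (by fun_prop)
  have hsub : ball (0 : ℂ) 1 ⊆ {w : ℂ | ‖x1 - x3 * w‖ ≤ ‖1 - x2 * w‖} := by
    intro w hw
    simp only [Set.mem_ofPred_eq]
    by_contra! hlt
    have h0 : x1 - x3 * w ≠ 0 := norm_pos_iff.1 ((norm_nonneg _).trans_lt hlt)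
    refine h ((1 - x2 * w) / (x1 - x3 * w)) ?_ w hw ?_
    · rw [uDisc, mem_ball_zero_iff, norm_div]
      exact (div_lt_one (norm_pos_iff.2 h0)).2 hlt
    · linear_combination -(div_mul_cancel₀ (1 - x2 * w) h0)
  have := closure_minimal hsub hcl
  rw [closure_ball 0 one_ne_zero] at this
  exact this (by simpa using hw)

lemma two_mul_norm_sub_le_of_mem_closedTetra {x1 x2 x3 : ℂ} (h : (x1, x2, x3) ∈ closedTetra) :
    2 * ‖x2 - star x1 * x3‖ ≤ 1 + ‖x2‖ ^ 2 - ‖x1‖ ^ 2 - ‖x3‖ ^ 2 := by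
  obtain ⟨w, hw, hB⟩ := exists_norm_eq_mul_self (x2 - star x1 * x3)
  have h1 := norm_sub_le_of_mem_closedTetra h hw.le
  have h2 : ‖x1 - x3 * w‖ ^ 2 ≤ ‖1 - x2 * w‖ ^ 2 := by gcongr
  have hre := congrArg Complex.re hB
  have hw2 : w.re * w.re + w.im * w.im = 1 := by
    rw [← normSq_apply, ← Complex.sq_norm, hw, one_pow]
  simp only [Complex.sq_norm, normSq_apply] at h2 ⊢
  simp at h2 hre ⊢
  nlinarith

lemma norm_sq_sub_star_mul (x1 x2 x3 : ℂ) :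
    ‖x2 - star x1 * x3‖ ^ 2 - ‖x1 * x2 - x3‖ ^ 2 =
      ‖x2‖ ^ 2 + ‖x1‖ ^ 2 * ‖x3‖ ^ 2 - ‖x1‖ ^ 2 * ‖x2‖ ^ 2 - ‖x3‖ ^ 2 := by
  simp only [Complex.sq_norm, normSq_apply]
  simp
  ring

lemma two_mul_norm_mul_sub_le_of_mem_closedTetra {x1 x2 x3 : ℂ}
    (h : (x1, x2, x3) ∈ closedTetra) :
    2 * ‖x1 * x2 - x3‖ ≤ 1 - ‖x1‖ ^ 2 - ‖x2‖ ^ 2 + ‖x3‖ ^ 2 := by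
  have hB := two_mul_norm_sub_le_of_mem_closedTetra h
  have hid := norm_sq_sub_star_mul x1 x2 x3
  have hab : ‖x1‖ * ‖x2‖ ≤ ‖x1 * x2 - x3‖ + ‖x3‖ := by
    rw [← norm_mul]; simpa using norm_add_le (x1 * x2 - x3) x3
  have ha := norm_fst_le_one_of_mem_closedTetra h
  have hb := norm_snd_le_one_of_mem_closedTetra h
  have ha0 := norm_nonneg x1
  have hb0 := norm_nonneg x2
  have hc0 := norm_nonneg x3
  have ht0 := norm_nonneg (x1 * x2 - x3)
  have hB0 := norm_nonneg (x2 - star x1 * x3)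
  generalize ‖x1 * x2 - x3‖ = t at *
  generalize ‖x2 - star x1 * x3‖ = B at *
  generalize ‖x1‖ = a at *
  generalize ‖x2‖ = b at *
  generalize ‖x3‖ = c at *
  have hC : 4 * t ^ 2 ≤ (1 - a ^ 2 - b ^ 2 + c ^ 2) ^ 2 := by
    have : (2 * B) ^ 2 ≤ (1 + b ^ 2 - a ^ 2 - c ^ 2) ^ 2 := by gcongr
    nlinarith
  by_contra! hlt
  have hle : 1 - a ^ 2 - b ^ 2 + c ^ 2 ≤ -(2 * t) := by nlinarith
  have hab1 : a * b ≤ 1 := mul_le_one₀ ha hb0 hb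
  have hab0 : 0 ≤ a * b := mul_nonneg ha0 hb0
  have hprod : 0 ≤ (1 - a ^ 2) * (1 - b ^ 2) := by
    apply mul_nonneg <;> nlinarith
  rcases le_total t (a * b) with htab | htab
  · have : (a * b - t) ^ 2 ≤ c ^ 2 := by
      apply pow_le_pow_left₀ <;> linarith
    have h1 : 0 ≤ t * (1 - a * b) := mul_nonneg ht0 (by linarith)
    have h2 : t ^ 2 ≤ 0 := by nlinarith
    have h3 : t = 0 := by nlinarith
    subst h3
    nlinarith
  · nlinarith

lemma contraction_of_mem_closedTetra {x1 x2 x3 a b : ℂ}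
    (h : (x1, x2, x3) ∈ closedTetra) (hab : a * b = x1 * x2 - x3) (hn : ‖a‖ = ‖b‖) (u v : ℂ) :
    ‖x1 * u + a * v‖ ^ 2 + ‖b * u + x2 * v‖ ^ 2 ≤ ‖u‖ ^ 2 + ‖v‖ ^ 2 := by
  have hC := two_mul_norm_mul_sub_le_of_mem_closedTetra h
  have hB := two_mul_norm_sub_le_of_mem_closedTetra h
  have hB' := two_mul_norm_sub_le_of_mem_closedTetra (closedTetra_swap h)
  have hB0 := norm_nonneg (x2 - star x1 * x3)
  have hB0' := norm_nonneg (x1 - star x2 * x3)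
  have ht : ‖x1 * x2 - x3‖ = ‖b‖ ^ 2 := by rw [← hab, norm_mul, hn, sq]
  have hx3 : x3 = x1 * x2 - a * b := by rw [hab]; ring
  have ha2 : ‖a‖ ^ 2 = ‖b‖ ^ 2 := by rw [hn]
  rw [ht] at hC
  set d1 := 1 - ‖x1‖ ^ 2 - ‖b‖ ^ 2 with hd1
  set d2 := 1 - ‖x2‖ ^ 2 - ‖b‖ ^ 2 with hd2
  set o : ℂ := star x1 * a + star b * x2 with ho
  have hdet : d1 * d2 - ‖o‖ ^ 2 = 1 - ‖x1‖ ^ 2 - ‖x2‖ ^ 2 + ‖x3‖ ^ 2 - 2 * ‖b‖ ^ 2 := by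
    have : ‖o‖ ^ 2 + ‖x3‖ ^ 2 = (‖x1‖ ^ 2 + ‖b‖ ^ 2) * (‖x2‖ ^ 2 + ‖a‖ ^ 2) := by
      rw [hx3, ho]
      simp only [Complex.sq_norm, normSq_apply]
      simp
      ring
    rw [hd1, hd2]
    rw [ha2] at this
    linear_combination -this
  have hsum : 0 ≤ d1 + d2 := by nlinarith
  have hprod : ‖o‖ ^ 2 ≤ d1 * d2 := by linarith
  have ho0 : 0 ≤ ‖o‖ ^ 2 := sq_nonneg _
  have h1 : 0 ≤ d1 := by nlinarith
  have h2 : 0 ≤ d2 := by nlinarith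
  have hexp : ‖u‖ ^ 2 + ‖v‖ ^ 2 - (‖x1 * u + a * v‖ ^ 2 + ‖b * u + x2 * v‖ ^ 2) =
      d1 * ‖u‖ ^ 2 + d2 * ‖v‖ ^ 2 - 2 * (star u * o * v).re + (‖b‖ ^ 2 - ‖a‖ ^ 2) * ‖v‖ ^ 2 := by
    rw [hd1, hd2, ho]
    simp only [Complex.sq_norm, normSq_apply]
    simp
    ring
  have hre : (star u * o * v).re ≤ ‖u‖ * ‖o‖ * ‖v‖ := by
    simpa using re_le_norm (star u * o * v)
  have hkey : 2 * (‖u‖ * ‖o‖ * ‖v‖) ≤ d1 * ‖u‖ ^ 2 + d2 * ‖v‖ ^ 2 := by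
    have hu := norm_nonneg u
    have hv := norm_nonneg v
    have ho1 : ‖o‖ ≤ √d1 * √d2 := by
      rw [← Real.sqrt_mul h1]
      exact Real.le_sqrt_of_sq_le hprod
    have h3 : ‖u‖ * ‖o‖ * ‖v‖ ≤ ‖u‖ * (√d1 * √d2) * ‖v‖ := by gcongr
    nlinarith [sq_nonneg (√d1 * ‖u‖ - √d2 * ‖v‖), Real.sq_sqrt h1, Real.sq_sqrt h2]
  rw [ha2] at hexp
  linarith

lemma mem_closedTetra_of_contraction (A : Matrix (Fin 2) (Fin 2) ℂ)
    (hA : ∀ v : Fin 2 → ℂ, ∑ i, ‖(A *ᵥ v) i‖ ^ 2 ≤ ∑ i, ‖v i‖ ^ 2) :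
    (A 0 0, A 1 1, A.det) ∈ closedTetra := by
  intro z hz w hw h0
  have hdet : (1 - A * diagonal ![z, w]).det = 0 := by
    rw [det_one_sub_mul_diagonal]; simpa using h0
  obtain ⟨v, hv, h⟩ := exists_mulVec_eq_zero_iff.2 hdet
  have hfix : v = A *ᵥ (diagonal ![z, w] *ᵥ v) := by
    rw [sub_mulVec, one_mulVec, sub_eq_zero] at h
    rw [mulVec_mulVec]; exact h
  have hle := hA (diagonal ![z, w] *ᵥ v)
  rw [← hfix] at hle
  simp only [mulVec_diagonal, Fin.sum_univ_two, norm_mul, mul_pow] at hle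
  simp only [uDisc, mem_ball_zero_iff] at hz hw
  have hz2 : ‖z‖ ^ 2 < 1 := by have := norm_nonneg z; nlinarith
  have hw2 : ‖w‖ ^ 2 < 1 := by have := norm_nonneg w; nlinarith
  simp at hle
  have h0' : ‖v 0‖ ^ 2 = 0 := by nlinarith [sq_nonneg ‖v 0‖, sq_nonneg ‖v 1‖]
  have h1' : ‖v 1‖ ^ 2 = 0 := by nlinarith [sq_nonneg ‖v 0‖, sq_nonneg ‖v 1‖]
  apply hv
  ext i
  fin_cases i
  · simpa using h0'
  · simpa using h1'

section SzegoKernel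

variable {ι : Type*} [Fintype ι]

lemma star_div_sub_of_mem_sphere {r : ℝ} (hr : 0 < r) {l ζ : ℂ} (hl : ‖l‖ < r)
    (hζ : ζ ∈ sphere (0 : ℂ) r) :
    star (ζ / (ζ - l)) = (r : ℂ) ^ 2 / ((r : ℂ) ^ 2 - star l * ζ) := by
  rw [mem_sphere_zero_iff_norm] at hζ
  have h0 : ζ ≠ 0 := norm_pos_iff.1 (hζ ▸ hr)
  have h1 : ζ * star ζ = (r : ℂ) ^ 2 := by
    rw [← hζ]; exact Complex.mul_conj' ζ
  have h2 : ζ - l ≠ 0 := sub_ne_zero.2 (by rintro rfl; exact hl.ne hζ)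
  have h3 : star ζ - star l ≠ 0 := by rw [← star_sub]; exact star_ne_zero.2 h2
  rw [← h1, star_div₀, star_sub, mul_comm (star l), ← mul_sub, mul_div_mul_left _ _ h0]

lemma sq_sub_star_mul_ne_zero {r : ℝ} {l ζ : ℂ} (hl : ‖l‖ < r) (hζ : ‖ζ‖ ≤ r) :
    (r : ℂ) ^ 2 - star l * ζ ≠ 0 := by
  intro h
  have h1 := congrArg norm (sub_eq_zero.1 h)
  simp only [norm_pow, norm_mul, norm_star, norm_real, Real.norm_eq_abs, sq_abs] at h1
  have := norm_nonneg l
  have := norm_nonneg ζ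
  nlinarith

lemma circleAverage_star_mul_kernel {r : ℝ} (hr : 0 < r) {l m : ℂ} (hl : ‖l‖ < r) (hm : ‖m‖ < r)
    {φ : ℂ → ℂ} (hφ : DiffContOnCl ℂ φ (ball 0 r)) :
    Real.circleAverage (fun ζ => star (ζ / (ζ - l)) * (φ ζ * (ζ / (ζ - m)))) 0 r =
      φ m * ((r : ℂ) ^ 2 / ((r : ℂ) ^ 2 - star l * m)) := by
  have habs : |r| = r := abs_of_pos hr
  have hg : DiffContOnCl ℂ (fun ζ => φ ζ * ((r : ℂ) ^ 2 / ((r : ℂ) ^ 2 - star l * ζ)))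
      (ball 0 |r|) := by
    rw [habs]
    refine hφ.smul (DifferentiableOn.diffContOnCl ?_)
    rw [closure_ball 0 hr.ne']
    intro ζ hζ
    refine DifferentiableAt.differentiableWithinAt ?_
    have := sq_sub_star_mul_ne_zero hl (by simpa using hζ)
    fun_prop (disch := assumption)
  rw [← hg.circleAverage_smul_div (w := m) (by simpa [habs] using hm)]
  refine Real.circleAverage_congr_sphere fun ζ hζ => ?_
  rw [habs] at hζ
  simp only [star_div_sub_of_mem_sphere hr hl hζ, sub_zero, smul_eq_mul]
  ring

lemma continuousOn_kernel {r : ℝ} {l : ℂ} (hl : ‖l‖ < r) :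
    ContinuousOn (fun ζ : ℂ => ζ / (ζ - l)) (sphere 0 r) := by
  refine ContinuousOn.div (by fun_prop) (by fun_prop) fun ζ hζ => sub_ne_zero.2 ?_
  rintro rfl
  exact hl.ne (by simpa using hζ)

lemma circleIntegrable_kernel_sum {r : ℝ} (hr : 0 < r) {l : ι → ℂ} (hl : ∀ j, ‖l j‖ < r)
    (c : ι → ℂ) {φ : ι → ℂ → ℂ} (hφ : ∀ j, DiffContOnCl ℂ (φ j) (ball 0 r)) :
    CircleIntegrable (fun ζ => star (∑ i, c i * (ζ / (ζ - l i))) *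
      ∑ j, φ j ζ * (ζ / (ζ - l j))) 0 r := by
  refine ContinuousOn.circleIntegrable hr.le ?_
  have hk := fun j => continuousOn_kernel (hl j)
  have hφ' : ∀ j, ContinuousOn (φ j) (sphere 0 r) := fun j => by
    refine (hφ j).continuousOn.mono ?_
    rw [closure_ball 0 hr.ne']
    exact sphere_subset_closedBall
  refine ContinuousOn.mul (ContinuousOn.star ?_) ?_
  · exact continuousOn_finsetSum _ fun j _ => continuousOn_const.mul (hk j)
  · exact continuousOn_finsetSum _ fun j _ => (hφ' j).mul (hk j)

lemma circleAverage_kernel_sum {r : ℝ} (hr : 0 < r) {l : ι → ℂ} (hl : ∀ j, ‖l j‖ < r)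
    (c : ι → ℂ) {φ : ι → ℂ → ℂ} (hφ : ∀ j, DiffContOnCl ℂ (φ j) (ball 0 r)) :
    Real.circleAverage (fun ζ => star (∑ i, c i * (ζ / (ζ - l i))) *
      ∑ j, φ j ζ * (ζ / (ζ - l j))) 0 r =
    ∑ i, ∑ j, star (c i) * φ j (l j) * ((r : ℂ) ^ 2 / ((r : ℂ) ^ 2 - star (l i) * l j)) := by
  have hk := fun j => continuousOn_kernel (hl j)
  have hφ' : ∀ j, ContinuousOn (φ j) (sphere 0 r) := fun j => by
    refine (hφ j).continuousOn.mono ?_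
    rw [closure_ball 0 hr.ne']
    exact sphere_subset_closedBall
  have hint : ∀ i j, CircleIntegrable
      (fun ζ => star (c i) • (star (ζ / (ζ - l i)) * (φ j ζ * (ζ / (ζ - l j))))) 0 r :=
    fun i j => by
      refine ContinuousOn.circleIntegrable hr.le ?_
      have h : ContinuousOn (fun ζ => star (ζ / (ζ - l i)) * (φ j ζ * (ζ / (ζ - l j))))
        (sphere 0 r) := (hk i).star.mul ((hφ' j).mul (hk j))
      exact (continuousOn_const (c := star (c i))).smul h
  have hfun : (fun ζ => star (∑ i, c i * (ζ / (ζ - l i))) * ∑ j, φ j ζ * (ζ / (ζ - l j))) =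
      fun ζ => ∑ i, ∑ j, star (c i) • (star (ζ / (ζ - l i)) * (φ j ζ * (ζ / (ζ - l j)))) := by
    ext ζ
    simp only [star_sum, star_mul', Finset.sum_mul_sum, smul_eq_mul]
    refine Finset.sum_congr rfl fun i _ => Finset.sum_congr rfl fun j _ => ?_
    ring
  rw [hfun, Real.circleAverage_fun_sum fun i _ => CircleIntegrable.fun_sum _ fun j _ => hint i j]
  refine Finset.sum_congr rfl fun i _ => ?_
  rw [Real.circleAverage_fun_sum fun j _ => hint i j]
  refine Finset.sum_congr rfl fun j _ => ?_
  rw [Real.circleAverage_fun_smul, circleAverage_star_mul_kernel hr (hl i) (hl j) (hφ j),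
    smul_eq_mul, mul_assoc]

/-- Positivity of the Szegő-type kernel of a matrix function which is contractive on a circle. -/
lemma re_kernel_nonneg_of_contraction {r : ℝ} (hr : 0 < r) {l : ι → ℂ} (hl : ∀ j, ‖l j‖ < r)
    {F : ℂ → Matrix (Fin 2) (Fin 2) ℂ}
    (hF : ∀ s t, DiffContOnCl ℂ (fun ζ => F ζ s t) (ball 0 r))
    (hcontr : ∀ ζ ∈ sphere (0 : ℂ) r, ∀ v : Fin 2 → ℂ,
      ∑ s, ‖(F ζ *ᵥ v) s‖ ^ 2 ≤ ∑ s, ‖v s‖ ^ 2)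
    (c : ι → Fin 2 → ℂ) :
    0 ≤ (∑ i, ∑ j, (star (c i) ⬝ᵥ c j - star (F (l i) *ᵥ c i) ⬝ᵥ (F (l j) *ᵥ c j)) *
      ((r : ℂ) ^ 2 / ((r : ℂ) ^ 2 - star (l i) * l j))).re := by
  have habs : |r| = r := abs_of_pos hr
  have hφ : ∀ s j, DiffContOnCl ℂ (fun ζ => (F ζ *ᵥ c j) s) (ball 0 r) := by
    intro s j
    have : (fun ζ => (F ζ *ᵥ c j) s) = fun ζ => c j 0 • F ζ s 0 + c j 1 • F ζ s 1 := by
      ext ζ; simp [mulVec, dotProduct, Fin.sum_univ_two, mul_comm]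
    rw [this]
    exact ((hF s 0).const_smul (c j 0)).add ((hF s 1).const_smul (c j 1))
  have hconst : ∀ a : ℂ, DiffContOnCl ℂ (fun _ => a) (ball (0 : ℂ) r) :=
    fun a => diffContOnCl_const
  set k : ι → ℂ → ℂ := fun j ζ => ζ / (ζ - l j) with hk
  set u : Fin 2 → ℂ → ℂ := fun s ζ => ∑ j, c j s * k j ζ with hu
  set p : Fin 2 → ℂ → ℂ := fun s ζ => ∑ j, (F (l j) *ᵥ c j) s * k j ζ with hp
  set e : Fin 2 → ℂ → ℂ := fun s ζ => ∑ j, (F ζ *ᵥ c j) s * k j ζ with he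
  have iu : ∀ s, CircleIntegrable (fun ζ => star (u s ζ) * u s ζ) 0 r := fun s =>
    circleIntegrable_kernel_sum hr hl (fun j => c j s) fun j => hconst (c j s)
  have ip : ∀ s, CircleIntegrable (fun ζ => star (p s ζ) * p s ζ) 0 r := fun s =>
    circleIntegrable_kernel_sum hr hl _ fun j => hconst ((F (l j) *ᵥ c j) s)
  have ie : ∀ s, CircleIntegrable (fun ζ => star (p s ζ) * e s ζ) 0 r := fun s =>
    circleIntegrable_kernel_sum hr hl (fun j => (F (l j) *ᵥ c j) s) (hφ s)
  have au := fun s => circleAverage_kernel_sum hr hl (fun j => c j s) fun j => hconst (c j s)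
  have ap := fun s => circleAverage_kernel_sum hr hl (fun j => (F (l j) *ᵥ c j) s)
    fun j => hconst ((F (l j) *ᵥ c j) s)
  have ae := fun s => circleAverage_kernel_sum hr hl (fun j => (F (l j) *ᵥ c j) s) (hφ s)
  set H : ℂ → ℂ := fun ζ => ∑ s, (star (u s ζ) * u s ζ + star (p s ζ) * p s ζ -
    (star (p s ζ) * e s ζ + star (p s ζ) * e s ζ)) with hH
  have iup : ∀ s, CircleIntegrable
      (fun ζ => star (u s ζ) * u s ζ + star (p s ζ) * p s ζ) 0 r := fun s => (iu s).add (ip s)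
  have iee : ∀ s, CircleIntegrable
      (fun ζ => star (p s ζ) * e s ζ + star (p s ζ) * e s ζ) 0 r := fun s => (ie s).add (ie s)
  have iH1 : ∀ s, CircleIntegrable (fun ζ => star (u s ζ) * u s ζ + star (p s ζ) * p s ζ -
      (star (p s ζ) * e s ζ + star (p s ζ) * e s ζ)) 0 r := fun s =>
    (iup s).sub (iee s)
  have iH : CircleIntegrable H 0 r := CircleIntegrable.fun_sum _ fun s _ => iH1 s
  have havg : Real.circleAverage H 0 r =
      ∑ i, ∑ j, (star (c i) ⬝ᵥ c j - star (F (l i) *ᵥ c i) ⬝ᵥ (F (l j) *ᵥ c j)) *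
      ((r : ℂ) ^ 2 / ((r : ℂ) ^ 2 - star (l i) * l j)) := by
    rw [hH, Real.circleAverage_fun_sum fun s _ => iH1 s]
    have : ∀ s, Real.circleAverage (fun ζ => star (u s ζ) * u s ζ + star (p s ζ) * p s ζ -
      (star (p s ζ) * e s ζ + star (p s ζ) * e s ζ)) 0 r =
        ∑ i, ∑ j, (star (c i s) * c j s -
          star ((F (l i) *ᵥ c i) s) * ((F (l j) *ᵥ c j) s)) *
          ((r : ℂ) ^ 2 / ((r : ℂ) ^ 2 - star (l i) * l j)) := by
      intro s
      rw [Real.circleAverage_fun_sub (iup s) (iee s),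
        Real.circleAverage_fun_add (iu s) (ip s), Real.circleAverage_fun_add (ie s) (ie s)]
      simp only [hu, hp, he, hk]
      rw [au s, ap s, ae s]
      simp only [← Finset.sum_add_distrib, ← Finset.sum_sub_distrib]
      refine Finset.sum_congr rfl fun i _ => Finset.sum_congr rfl fun j _ => ?_
      ring
    rw [Finset.sum_congr rfl fun s _ => this s, Finset.sum_comm]
    refine Finset.sum_congr rfl fun i _ => ?_
    rw [Finset.sum_comm]
    refine Finset.sum_congr rfl fun j _ => ?_
    simp only [dotProduct, Pi.star_apply, ← Finset.sum_sub_distrib, Finset.sum_mul]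
  rw [← havg]
  have hre := reCLM.circleAverage_comp_comm iH
  rw [reCLM_apply] at hre
  rw [← hre]
  refine Real.circleAverage_nonneg_of_nonneg fun ζ hζ => ?_
  rw [habs] at hζ
  have h1 : ∀ s, e s ζ = (F ζ *ᵥ fun t => u t ζ) s := by
    intro s
    simp only [he, hu, mulVec, dotProduct, Fin.sum_univ_two, Finset.mul_sum,
      ← Finset.sum_add_distrib]
    refine Finset.sum_congr rfl fun j _ => ?_
    ring
  have h2 := hcontr ζ hζ fun t => u t ζ
  simp only [← h1] at h2
  have h3 : ∀ x y z : ℂ, (star x * x + star y * y - (star y * z + star y * z)).re =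
      ‖x‖ ^ 2 + ‖z - y‖ ^ 2 - ‖z‖ ^ 2 := by
    intro x y z
    simp only [Complex.sq_norm, normSq_apply]
    simp
    ring
  simp only [Fin.sum_univ_two] at h2
  simp only [Function.comp_apply, reCLM_apply, hH, re_sum, h3]
  rw [Fin.sum_univ_two]
  nlinarith [sq_nonneg ‖e 0 ζ - p 0 ζ‖, sq_nonneg ‖e 1 ζ - p 1 ζ‖]

end SzegoKernel

section BalancedFactorization

/-- A function analytic near a closed disc without zeros on the bounding circle is the product of
a finite Blaschke product and a nowhere vanishing analytic function. -/
lemma exists_blaschke_factorization {r : ℝ} (hr : 0 < r) {g : ℂ → ℂ}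
    (hg : AnalyticOnNhd ℂ g (closedBall 0 r)) (hg0 : ∀ z ∈ sphere (0 : ℂ) r, g z ≠ 0) :
    ∃ b h : ℂ → ℂ, AnalyticOnNhd ℂ b (closedBall 0 r) ∧ AnalyticOnNhd ℂ h (closedBall 0 r) ∧
      (∀ z ∈ closedBall (0 : ℂ) r, h z ≠ 0) ∧ (∀ z ∈ closedBall (0 : ℂ) r, g z = b z * h z) ∧
      ∀ z ∈ sphere (0 : ℂ) r, ‖b z‖ = 1 := by
  have hpc : IsPreconnected (closedBall (0 : ℂ) r) := (convex_closedBall 0 r).isPreconnected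
  have hmer : MeromorphicOn g (closedBall 0 r) := hg.meromorphicOn
  have hrs : (r : ℂ) ∈ sphere (0 : ℂ) r := by simp [abs_of_pos hr]
  have htop : ∀ u : closedBall (0 : ℂ) r, meromorphicOrderAt g u ≠ ⊤ := by
    refine (hmer.exists_meromorphicOrderAt_ne_top_iff_forall
      ⟨⟨0, by simp [hr.le]⟩, hpc⟩).1 ⟨⟨r, sphere_subset_closedBall hrs⟩, ?_⟩
    have : meromorphicOrderAt g r = 0 :=
      ((hg _ (sphere_subset_closedBall hrs)).meromorphicNFAt.meromorphicOrderAt_eq_zero_iff).2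
        (hg0 _ hrs)
    simp [this]
  obtain ⟨h, D⟩ := hmer.exists_ecanonicalDecomp htop
  have hfin : (MeromorphicOn.divisor g (ball 0 r)).support.Finite :=
    hmer.divisor_ball_support_finite
  set d := MeromorphicOn.divisor g (ball 0 r) with hd
  have hmem : ∀ i ∈ hfin.toFinset, i ∈ ball (0 : ℂ) r := fun i hi =>
    d.supportWithinDomain (hfin.mem_toFinset.1 hi)
  have hdnn : 0 ≤ d := MeromorphicOn.AnalyticOnNhd.divisor_nonneg (hg.mono ball_subset_closedBall)
  set b : ℂ → ℂ := fun z =>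
    ∏ i ∈ hfin.toFinset, ((r * (z - i)) / ((r : ℂ) ^ 2 - star i * z)) ^ (d i).toNat with hb
  have hbc : ∀ z, b z = ∏ i ∈ hfin.toFinset, canonicalFactor r i z ^ (-d i) := by
    intro z
    refine Finset.prod_congr rfl fun i _ => ?_
    rw [canonicalFactor_apply, _root_.zpow_neg, ← _root_.inv_zpow, inv_div, ← zpow_natCast,
      Int.toNat_of_nonneg (hdnn i)]
    rfl
  have hban : AnalyticOnNhd ℂ b (closedBall 0 r) := by
    intro z hz
    refine Finset.analyticAt_fun_prod _ fun i hi => AnalyticAt.fun_pow ?_ _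
    have h1 := sq_sub_star_mul_ne_zero (l := i) (by simpa using hmem i hi) (by simpa using hz)
    exact AnalyticAt.fun_div (by fun_prop) (by fun_prop) h1
  have hsph : MeromorphicOn.divisor g (sphere 0 r) = 0 := by
    ext z
    by_cases hz : z ∈ sphere (0 : ℂ) r
    · have : meromorphicOrderAt g z = 0 :=
        ((hg _ (sphere_subset_closedBall hz)).meromorphicNFAt.meromorphicOrderAt_eq_zero_iff).2
          (hg0 _ hz)
      rw [MeromorphicOn.divisor_apply (hmer.mono_set sphere_subset_closedBall) hz, this]
      rfl
    · exact Function.locallyFinsuppWithin.apply_eq_zero_of_notMem _ hz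
  have heq : g =ᶠ[Filter.codiscreteWithin (closedBall 0 r)] fun z => b z * h z := by
    refine D.eventuallyEq.trans (Filter.Eventually.of_forall fun z => ?_)
    rw [finprod_eq_prod_of_mulSupport_subset_of_finite (s := d.support) _ ?_ hfin]
    · simp [hsph, hbc, hd]
    · intro i hi
      contrapose! hi
      simp only [Function.mem_support, not_not] at hi
      simp [← hd, hi]
  refine ⟨b, h, hban, D.analyticOnNhd, D.ne_zero, fun z hz => ?_, fun z hz => ?_⟩
  · have han := (hban z hz).fun_mul (D.analyticOnNhd z hz)
    have hU : Preperfect (closedBall (0 : ℂ) r) := by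
      rw [← closure_ball 0 hr.ne']
      exact (isOpen_ball.perfect_closure).2
    have := (hmer z hz).eventuallyEq_nhdsNE_of_eventuallyEq_codiscreteWithin_preperfect
      han.meromorphicAt hz hU heq
    exact (((hg z hz).continuousAt.eventuallyEq_nhds_iff_eventuallyEq_nhdsNE
      han.continuousAt).1 this).self_of_nhds
  · rw [hbc, norm_prod]
    refine Finset.prod_eq_one fun i hi => ?_
    rw [norm_zpow, norm_canonicalFactor_eval_circle_eq_one (hmem i hi) hz, _root_.one_zpow]

/-- A nowhere vanishing analytic function near a closed disc has an analytic square root. -/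
lemma exists_sq_eq_of_ne_zero {r : ℝ} (hr : 0 < r) {h : ℂ → ℂ}
    (hh : AnalyticOnNhd ℂ h (closedBall 0 r)) (h0 : ∀ z ∈ closedBall (0 : ℂ) r, h z ≠ 0) :
    ∃ q : ℂ → ℂ, DiffContOnCl ℂ q (ball 0 r) ∧ ∀ z ∈ closedBall (0 : ℂ) r, q z * q z = h z := by
  have hopen : IsOpen {z | AnalyticAt ℂ h z ∧ h z ≠ 0} := by
    rw [isOpen_iff_mem_nhds]
    rintro z ⟨hz, hz0⟩
    exact hz.eventually_analyticAt.and (hz.continuousAt.eventually_ne hz0)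
  obtain ⟨δ, hδ, hδs⟩ := (isCompact_closedBall (0 : ℂ) r).exists_thickening_subset_open hopen
    (fun z hz => ⟨hh z hz, h0 z hz⟩)
  rw [thickening_closedBall hδ hr.le] at hδs
  have hd : DifferentiableOn ℂ (fun z => deriv h z / h z) (ball 0 (δ + r)) := fun z hz =>
    ((hδs hz).1.deriv.differentiableAt.fun_div (hδs hz).1.differentiableAt
      (hδs hz).2).differentiableWithinAt
  obtain ⟨L, hL⟩ := hd.isExactOn_ball
  have h00 : h 0 ≠ 0 := h0 0 (by simp [hr.le])
  set q : ℂ → ℂ := fun z => exp ((L z - L 0 + log (h 0)) / 2) with hq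
  have hLd : ∀ z ∈ ball (0 : ℂ) (δ + r), DifferentiableAt ℂ q z := fun z hz => by
    have := (hL z hz).differentiableAt
    fun_prop
  have hcb : closedBall (0 : ℂ) r ⊆ ball 0 (δ + r) := closedBall_subset_ball (by linarith)
  refine ⟨q, ?_, ?_⟩
  · refine DifferentiableOn.diffContOnCl ?_
    rw [closure_ball 0 hr.ne']
    exact fun z hz => (hLd z (hcb hz)).differentiableWithinAt
  · have hE : ∀ z ∈ ball (0 : ℂ) (δ + r),
        HasDerivAt (fun z => h z * exp (-(L z - L 0 + log (h 0)))) 0 z := by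
      intro z hz
      have h1 := (hδs hz).1.differentiableAt.hasDerivAt
      have h2 := (((hL z hz).sub_const (L 0)).add_const (log (h 0))).fun_neg.cexp
      have h3 := (hδs hz).2
      refine (h1.fun_mul h2).congr_deriv ?_
      field_simp
      ring
    intro z hz
    have hc := (isOpen_ball (x := (0 : ℂ)) (ε := δ + r)).is_const_of_deriv_eq_zero
      (convex_ball 0 _).isPreconnected
      (fun z hz => (hE z hz).differentiableAt.differentiableWithinAt)
      (fun z hz => (hE z hz).deriv) (hcb hz) (hcb (by simp [hr.le] : (0 : ℂ) ∈ closedBall 0 r))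
    simp only [sub_self, zero_add, Complex.exp_neg, exp_log h00, mul_inv_cancel₀ h00] at hc
    rw [hq, ← exp_add, add_halves]
    rw [← div_eq_mul_inv, div_eq_one_iff_eq (exp_ne_zero _)] at hc
    exact hc.symm

lemma exists_balanced_factorization {r : ℝ} (hr : 0 < r) {g : ℂ → ℂ}
    (hg : AnalyticOnNhd ℂ g (closedBall 0 r)) (hg0 : ∀ z ∈ sphere (0 : ℂ) r, g z ≠ 0) :
    ∃ f₁ f₂ : ℂ → ℂ, DiffContOnCl ℂ f₁ (ball 0 r) ∧ DiffContOnCl ℂ f₂ (ball 0 r) ∧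
      (∀ z ∈ closedBall (0 : ℂ) r, f₁ z * f₂ z = g z) ∧
      ∀ z ∈ sphere (0 : ℂ) r, ‖f₁ z‖ = ‖f₂ z‖ := by
  obtain ⟨b, h, hb, hh, hh0, hbh, hb1⟩ := exists_blaschke_factorization hr hg hg0
  obtain ⟨q, hq, hqq⟩ := exists_sq_eq_of_ne_zero hr hh hh0
  refine ⟨fun z => b z * q z, q, ?_, hq, fun z hz => ?_, fun z hz => ?_⟩
  · refine DiffContOnCl.smul (c := b) ?_ hq
    refine DifferentiableOn.diffContOnCl ?_
    rw [closure_ball 0 hr.ne']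
    exact hb.differentiableOn
  · rw [mul_assoc, hqq z hz, hbh z hz]
  · rw [norm_mul, hb1 z hz, one_mul]

end BalancedFactorization

section DiscKernel

/-- A nonzero analytic function on the disc is zero-free on circles of radius close to one. -/
lemma exists_radius_forall_ne_zero {g : ℂ → ℂ} (hg : AnalyticOnNhd ℂ g uDisc) {z₀ : ℂ}
    (hz₀ : z₀ ∈ uDisc) (hgz : g z₀ ≠ 0) {ε : ℝ} (hε : ε < 1) :
    ∃ r : ℝ, ε < r ∧ r < 1 ∧ ∀ z ∈ sphere (0 : ℂ) r, g z ≠ 0 := by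
  obtain ⟨ρ, hρ, hρ1⟩ := exists_between hε
  have hK : closedBall (0 : ℂ) ρ ⊆ uDisc := closedBall_subset_ball hρ1
  have hcod := hg.preimage_zero_mem_codiscreteWithin hgz hz₀
    ((convex_ball (0 : ℂ) 1).isConnected ⟨0, by simp⟩)
  rw [mem_codiscreteWithin_accPt] at hcod
  have hfin : (closedBall (0 : ℂ) ρ ∩ g ⁻¹' {0}).Finite := by
    by_contra hinf
    obtain ⟨x, hxK, hx⟩ := Set.Infinite.exists_accPt_of_subset_isCompact hinf
      (isCompact_closedBall (0 : ℂ) ρ) Set.inter_subset_left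
    refine hcod x (hK hxK) (hx.mono (Filter.principal_mono.2 ?_))
    rintro z ⟨hz, hz0⟩
    exact ⟨hK hz, by simpa using hz0⟩
  obtain ⟨r, hr, hrn⟩ := ((Set.Ioo_infinite hρ).sdiff (hfin.image norm)).nonempty
  refine ⟨r, hr.1, hr.2.trans hρ1, fun z hz h0 => hrn ⟨z, ⟨?_, h0⟩, by simpa using hz⟩⟩
  exact closedBall_subset_closedBall hr.2.le (sphere_subset_closedBall hz)

variable {ι : Type*} [Fintype ι]

lemma exists_kernel_nonneg_of_radius {l : ι → ℂ} {x₁ x₂ x₃ : ℂ → ℂ}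
    (h₁ : AnalyticOnNhd ℂ x₁ uDisc) (h₂ : AnalyticOnNhd ℂ x₂ uDisc)
    (h₃ : AnalyticOnNhd ℂ x₃ uDisc) (hx : ∀ z ∈ uDisc, (x₁ z, x₂ z, x₃ z) ∈ closedTetra)
    {r : ℝ} (hr : 0 < r) (hr1 : r < 1) (hl : ∀ j, ‖l j‖ < r)
    (h0 : ∀ z ∈ sphere (0 : ℂ) r, x₁ z * x₂ z - x₃ z ≠ 0) :
    ∃ a b : ι → ℂ, (∀ j, ‖a j‖ ≤ 1) ∧ (∀ j, ‖b j‖ ≤ 1) ∧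
      (∀ j, a j * b j = x₁ (l j) * x₂ (l j) - x₃ (l j)) ∧
      ∀ c : ι → Fin 2 → ℂ,
        0 ≤ (∑ i, ∑ j, (star (c i) ⬝ᵥ c j - star (!![x₁ (l i), a i; b i, x₂ (l i)] *ᵥ c i) ⬝ᵥ
          (!![x₁ (l j), a j; b j, x₂ (l j)] *ᵥ c j)) *
            ((r : ℂ) ^ 2 / ((r : ℂ) ^ 2 - star (l i) * l j))).re := by
  have hK : closedBall (0 : ℂ) r ⊆ uDisc := closedBall_subset_ball hr1
  have hg : AnalyticOnNhd ℂ (fun z => x₁ z * x₂ z - x₃ z) (closedBall 0 r) := fun z hz =>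
    ((h₁ z (hK hz)).fun_mul (h₂ z (hK hz))).fun_sub (h₃ z (hK hz))
  obtain ⟨f₁, f₂, hf₁, hf₂, hff, hn⟩ := exists_balanced_factorization hr hg h0
  have hdc : ∀ {y : ℂ → ℂ}, AnalyticOnNhd ℂ y uDisc → DiffContOnCl ℂ y (ball 0 r) := by
    intro y hy
    refine DifferentiableOn.diffContOnCl ?_
    rw [closure_ball 0 hr.ne']
    exact (hy.mono hK).differentiableOn
  have hcon : ∀ z ∈ sphere (0 : ℂ) r, ∀ u v : ℂ,
      ‖x₁ z * u + f₁ z * v‖ ^ 2 + ‖f₂ z * u + x₂ z * v‖ ^ 2 ≤ ‖u‖ ^ 2 + ‖v‖ ^ 2 := fun z hz =>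
    contraction_of_mem_closedTetra (hx z (hK (sphere_subset_closedBall hz)))
      (hff z (sphere_subset_closedBall hz)) (hn z hz)
  have hf1 : ∀ z ∈ sphere (0 : ℂ) r, ‖f₁ z‖ ≤ 1 := fun z hz => by
    have := hcon z hz 0 1
    simp only [mul_zero, mul_one, zero_add, norm_zero, norm_one] at this
    nlinarith [sq_nonneg ‖x₂ z‖, norm_nonneg (f₁ z)]
  have hmax : ∀ {f : ℂ → ℂ}, DiffContOnCl ℂ f (ball 0 r) →
      (∀ z ∈ sphere (0 : ℂ) r, ‖f z‖ ≤ 1) → ∀ j, ‖f (l j)‖ ≤ 1 := by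
    intro f hf hfs j
    refine norm_le_of_forall_mem_frontier_norm_le isBounded_ball hf ?_
      (subset_closure (by simpa using hl j))
    rwa [frontier_ball 0 hr.ne']
  refine ⟨fun j => f₁ (l j), fun j => f₂ (l j), hmax hf₁ hf1,
    hmax hf₂ fun z hz => hn z hz ▸ hf1 z hz,
    fun j => hff _ (by simpa using (hl j).le), fun c => ?_⟩
  refine re_kernel_nonneg_of_contraction hr hl
    (F := fun z => !![x₁ z, f₁ z; f₂ z, x₂ z]) ?_ ?_ c
  · intro s t
    fin_cases s <;> fin_cases t
    exacts [hdc h₁, hf₁, hf₂, hdc h₂]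
  · intro z hz v
    simpa [mulVec, dotProduct, Fin.sum_univ_two] using hcon z hz (v 0) (v 1)

/-- Analytic maps into the closed tetrablock admit, at any finite set of points, a choice of
off-diagonal entries making the de Branges–Rovnyak kernel positive. -/
lemma exists_kernel_nonneg {l : ι → ℂ} (hl : ∀ j, l j ∈ uDisc) {x₁ x₂ x₃ : ℂ → ℂ}
    (h₁ : AnalyticOnNhd ℂ x₁ uDisc) (h₂ : AnalyticOnNhd ℂ x₂ uDisc)
    (h₃ : AnalyticOnNhd ℂ x₃ uDisc) (hx : ∀ z ∈ uDisc, (x₁ z, x₂ z, x₃ z) ∈ closedTetra)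
    (hne : ∀ j, x₁ (l j) * x₂ (l j) ≠ x₃ (l j)) :
    ∃ a b : ι → ℂ, (∀ j, a j * b j = x₁ (l j) * x₂ (l j) - x₃ (l j)) ∧
      ∀ c : ι → Fin 2 → ℂ,
        0 ≤ (∑ i, ∑ j, (star (c i) ⬝ᵥ c j - star (!![x₁ (l i), a i; b i, x₂ (l i)] *ᵥ c i) ⬝ᵥ
          (!![x₁ (l j), a j; b j, x₂ (l j)] *ᵥ c j)) * (1 / (1 - star (l i) * l j))).re := by
  have hl' : ∀ j, ‖l j‖ < 1 := fun j => by simpa [uDisc] using hl j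
  rcases isEmpty_or_nonempty ι with _ | ⟨⟨j₀⟩⟩
  · exact ⟨isEmptyElim, isEmptyElim, isEmptyElim, by simp⟩
  obtain ⟨R, hR, hR1⟩ : ∃ R : ℝ, (∀ j, ‖l j‖ < R) ∧ R < 1 := by
    have : Nonempty ι := ⟨j₀⟩
    obtain ⟨i, hi⟩ := Finite.exists_max fun j => ‖l j‖
    obtain ⟨R, h1, h2⟩ := exists_between (hl' i)
    exact ⟨R, fun j => (hi j).trans_lt h1, h2⟩
  have hR0 : 0 < R := (norm_nonneg _).trans_lt (hR j₀)
  have hg : AnalyticOnNhd ℂ (fun z => x₁ z * x₂ z - x₃ z) uDisc := fun z hz =>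
    ((h₁ z hz).fun_mul (h₂ z hz)).fun_sub (h₃ z hz)
  have hrad : ∀ k : ℕ, ∃ r : ℝ, max R (1 - 1 / ((k : ℝ) + 1)) < r ∧ r < 1 ∧
      ∀ z ∈ sphere (0 : ℂ) r, x₁ z * x₂ z - x₃ z ≠ 0 := fun k =>
    exists_radius_forall_ne_zero hg (hl j₀) (sub_ne_zero.2 (hne j₀))
      (max_lt hR1 (sub_lt_self _ (by positivity)))
  choose r hr hr1 hr0 using hrad
  have hrR : ∀ k, R < r k := fun k => (le_max_left _ _).trans_lt (hr k)
  have hrlim : Filter.Tendsto r Filter.atTop (nhds 1) := by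
    refine tendsto_of_tendsto_of_tendsto_of_le_of_le (g := fun k : ℕ => 1 - 1 / ((k : ℝ) + 1))
      ?_ tendsto_const_nhds (fun k => ((le_max_right _ _).trans_lt (hr k)).le) fun k => (hr1 k).le
    simpa using (tendsto_one_div_add_atTop_nhds_zero_nat (𝕜 := ℝ)).const_sub 1
  choose a b ha hb hab hker using fun k => exists_kernel_nonneg_of_radius h₁ h₂ h₃ hx
    (hR0.trans (hrR k)) (hr1 k) (fun j => (hR j).trans (hrR k)) (hr0 k)
  obtain ⟨⟨a', b'⟩, -, φ, hφ, hlim⟩ := (isCompact_closedBall (0 : (ι → ℂ) × (ι → ℂ)) 1).tendsto_subseq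
    (x := fun k => (a k, b k)) fun k => by
      rw [mem_closedBall_zero_iff, Prod.norm_def]
      exact max_le ((pi_norm_le_iff_of_nonneg zero_le_one).2 (ha k))
        ((pi_norm_le_iff_of_nonneg zero_le_one).2 (hb k))
  have hr' : Filter.Tendsto (fun k => r (φ k)) Filter.atTop (nhds 1) :=
    hrlim.comp hφ.tendsto_atTop
  have hlim' : Filter.Tendsto (fun k => (a (φ k), b (φ k), r (φ k))) Filter.atTop
      (nhds (a', b', 1)) :=
    (hlim.fst_nhds).prodMk_nhds ((hlim.snd_nhds).prodMk_nhds hr')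
  refine ⟨a', b', fun j => ?_, fun c => ?_⟩
  · have hcont : Continuous fun p : (ι → ℂ) × (ι → ℂ) × ℝ => p.1 j * p.2.1 j := by fun_prop
    refine tendsto_nhds_unique ((hcont.tendsto _).comp hlim') ?_
    exact tendsto_const_nhds.congr fun k => (hab (φ k) j).symm
  · have hcont : ContinuousAt (fun p : (ι → ℂ) × (ι → ℂ) × ℝ =>
        (∑ i, ∑ j, (star (c i) ⬝ᵥ c j -
          star (!![x₁ (l i), p.1 i; p.2.1 i, x₂ (l i)] *ᵥ c i) ⬝ᵥ
          (!![x₁ (l j), p.1 j; p.2.1 j, x₂ (l j)] *ᵥ c j)) *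
            ((p.2.2 : ℂ) ^ 2 / ((p.2.2 : ℂ) ^ 2 - star (l i) * l j))).re) (a', b', 1) := by
      refine Complex.continuous_re.continuousAt.comp ?_
      refine tendsto_finsetSum _ fun i _ => tendsto_finsetSum _ fun j _ => ?_
      refine ContinuousAt.mul (Continuous.continuousAt ?_) (ContinuousAt.div ?_ ?_ ?_)
      · simp only [mulVec, dotProduct, Fin.sum_univ_two, Pi.star_apply]
        simp
        fun_prop
      · fun_prop
      · fun_prop
      · simpa using sq_sub_star_mul_ne_zero (r := 1) (hl' i) (hl' j).le
    have := ge_of_tendsto' (hcont.tendsto.comp hlim') fun k => hker (φ k) c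
    simpa using this

end DiscKernel

section PickMatrix

variable {n : ℕ}

lemma one_sub_star_mul_ne_zero {z w : ℂ} (hz : ‖z‖ < 1) (hw : ‖w‖ ≤ 1) : 1 - star z * w ≠ 0 := by
  simpa using sq_sub_star_mul_ne_zero (r := 1) hz hw

lemma one_sub_mul_ne_zero {z w : ℂ} (hw : ‖w‖ ≤ 1) (hz : z ∈ uDisc) : 1 - w * z ≠ 0 := by
  have hz' : ‖star z‖ < 1 := by simpa [uDisc] using hz
  simpa [mul_comm] using one_sub_star_mul_ne_zero hz' hw

lemma mulVec_of_mobius {x₁ x₂ x₃ a b z : ℂ} (hab : a * b = x₁ * x₂ - x₃) (hz : 1 - x₂ * z ≠ 0) :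
    !![x₁, a; b, x₂] *ᵥ ![1, z * (b / (1 - x₂ * z))] =
      ![(z * x₃ - x₁) / (x₂ * z - 1), b / (1 - x₂ * z)] := by
  have hz' : x₂ * z - 1 ≠ 0 := by rwa [← neg_ne_zero, neg_sub]
  ext s
  fin_cases s
  · simp only [Fin.zero_eta, mulVec, dotProduct, Fin.sum_univ_two]
    simp
    rw [eq_div_iff hz']
    linear_combination -(a * z) * div_mul_cancel₀ b hz - z * hab
  · simp only [Fin.mk_one, mulVec, dotProduct, Fin.sum_univ_two]
    simp
    field_simp
    ring

lemma posSemidef_of_re_nonneg {m : Type*} [Fintype m] {M : Matrix m m ℂ} (hM : M.IsHermitian)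
    (h : ∀ t : m → ℂ, 0 ≤ (∑ p, ∑ q, star (t p) * M p q * t q).re) : M.PosSemidef := by
  refine PosSemidef.of_dotProduct_mulVec_nonneg hM fun t => ?_
  rw [Complex.nonneg_iff]
  refine ⟨?_, (hM.im_star_dotProduct_mulVec_self t).symm⟩
  convert h t using 2
  simp [mulVec, dotProduct, Finset.mul_sum, mul_assoc]

lemma exists_posSemidef_of_kernel_nonneg {lam x₁ x₂ x₃ a b : Fin n → ℂ}
    (hlam : ∀ j, lam j ∈ uDisc) (hx₂ : ∀ j, ‖x₂ j‖ ≤ 1)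
    (hab : ∀ j, a j * b j = x₁ j * x₂ j - x₃ j)
    (hker : ∀ c : Fin n → Fin 2 → ℂ,
      0 ≤ (∑ i, ∑ j, (star (c i) ⬝ᵥ c j - star (!![x₁ i, a i; b i, x₂ i] *ᵥ c i) ⬝ᵥ
        (!![x₁ j, a j; b j, x₂ j] *ᵥ c j)) * (1 / (1 - star (lam i) * lam j))).re)
    {zs : Fin 3 → ℂ} (hzs : ∀ k, zs k ∈ uDisc) :
    ∃ N M : Matrix (Fin n × Fin 3) (Fin n × Fin 3) ℂ,
      N.PosSemidef ∧ N.rank ≤ 1 ∧ M.PosSemidef ∧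
      (Matrix.of fun p q : Fin n × Fin 3 =>
        1 - star ((zs p.2 * x₃ p.1 - x₁ p.1) / (x₂ p.1 * zs p.2 - 1)) *
              ((zs q.2 * x₃ q.1 - x₁ q.1) / (x₂ q.1 * zs q.2 - 1)) -
          (1 - star (zs p.2) * zs q.2) * N p q -
            (1 - star (lam p.1) * lam q.1) * M p q).PosSemidef := by
  set γ : Fin n × Fin 3 → ℂ := fun p => b p.1 / (1 - x₂ p.1 * zs p.2) with hγ
  set ψ : Fin n × Fin 3 → ℂ := fun p => (zs p.2 * x₃ p.1 - x₁ p.1) / (x₂ p.1 * zs p.2 - 1) with hψ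
  set η : Fin n × Fin 3 → Fin 2 → ℂ := fun p => ![1, zs p.2 * γ p] with hη
  have hFη : ∀ p, !![x₁ p.1, a p.1; b p.1, x₂ p.1] *ᵥ η p = ![ψ p, γ p] := fun p =>
    mulVec_of_mobius (hab p.1) (one_sub_mul_ne_zero (hx₂ p.1) (hzs p.2))
  set M : Matrix (Fin n × Fin 3) (Fin n × Fin 3) ℂ := Matrix.of fun p q =>
    (star (η p) ⬝ᵥ η q - star (![ψ p, γ p]) ⬝ᵥ ![ψ q, γ q]) *
      (1 / (1 - star (lam p.1) * lam q.1)) with hM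
  refine ⟨vecMulVec (star γ) γ, M, posSemidef_vecMulVec_star_self γ, rank_vecMulVec_le _ _,
    posSemidef_of_re_nonneg ?_ fun t => ?_, ?_⟩
  · ext p q
    simp only [hM, conjTranspose_apply, of_apply, star_mul', star_sub, star_div₀, star_one,
      star_star, ← star_dotProduct_star, mul_comm (lam _)]
  · convert hker fun j => ∑ k, t (j, k) • η (j, k) using 2
    rw [Fintype.sum_prod_type]
    refine Finset.sum_congr rfl fun i _ => ?_
    simp_rw [Fintype.sum_prod_type]
    rw [Finset.sum_comm]
    refine Finset.sum_congr rfl fun j _ => ?_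
    simp only [mulVec_sum, mulVec_smul, star_sum, sum_dotProduct, dotProduct_sum, star_smul,
      smul_dotProduct, dotProduct_smul, smul_eq_mul, Finset.mul_sum,
      ← Finset.sum_sub_distrib, Finset.sum_mul]
    rw [Finset.sum_comm]
    refine Finset.sum_congr rfl fun k _ => Finset.sum_congr rfl fun k' _ => ?_
    rw [hFη (i, k'), hFη (j, k), hM, of_apply]
    ring
  · convert PosSemidef.zero
    ext p q
    have h := one_sub_star_mul_ne_zero (z := lam p.1) (w := lam q.1)
      (by simpa [uDisc] using hlam p.1) (by simpa [uDisc] using (mem_ball.1 (hlam q.1)).le)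
    simp only [hM, of_apply, vecMulVec_apply, Pi.star_apply, one_div, Matrix.zero_apply]
    rw [mul_left_comm _ _ (_)⁻¹, mul_inv_cancel₀ h]
    simp only [hη, hψ, dotProduct, Fin.sum_univ_two, Pi.star_apply]
    simp
    ring

end PickMatrix

section Realization

open scoped MatrixOrder Matrix.Norms.L2Operator in
lemma exists_eq_conjTranspose_mul_self {m : Type*} [Fintype m] {M : Matrix m m ℂ}
    (hM : M.PosSemidef) : ∃ B : Matrix m m ℂ, M = Bᴴ * B := by
  classical
  exact CStarAlgebra.nonneg_iff_eq_star_mul_self.mp hM.nonneg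

lemma exists_eq_star_mul_of_rank_le_one {m : Type*} [Fintype m] {N : Matrix m m ℂ}
    (hN : N.PosSemidef) (hr : N.rank ≤ 1) : ∃ γ : m → ℂ, ∀ p q, N p q = star (γ p) * γ q := by
  classical
  obtain ⟨B, rfl⟩ := exists_eq_conjTranspose_mul_self hN
  rw [rank_conjTranspose_mul_self, Matrix.rank, finrank_le_one_iff] at hr
  obtain ⟨⟨v, hv⟩, h⟩ := hr
  have h' : ∀ q, ∃ c : ℂ, ∀ p, B p q = c * v p := fun q => by
    obtain ⟨c, hc⟩ := h ⟨B.mulVecLin (Pi.single q 1), LinearMap.mem_range_self _ _⟩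
    refine ⟨c, fun p => ?_⟩
    have := congrFun (congrArg Subtype.val hc) p
    simpa using this.symm
  choose c hc using h'
  set s : ℝ := ∑ p, ‖v p‖ ^ 2 with hs
  have hs0 : 0 ≤ s := Finset.sum_nonneg fun p _ => sq_nonneg _
  have hss : ((Real.sqrt s : ℝ) : ℂ) * (Real.sqrt s : ℝ) = ∑ p, star (v p) * v p := by
    rw [← ofReal_mul, Real.mul_self_sqrt hs0, hs]
    push_cast
    exact Finset.sum_congr rfl fun p _ => (Complex.conj_mul' (v p)).symm
  refine ⟨fun p => Real.sqrt s * c p, fun p q => ?_⟩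
  calc (Bᴴ * B) p q = star (c p) * c q * ∑ i, star (v i) * v i := by
        rw [mul_apply, Finset.mul_sum]
        refine Finset.sum_congr rfl fun i _ => ?_
        rw [conjTranspose_apply, hc, hc, star_mul']
        ring
    _ = _ := by
        rw [← hss, star_mul']
        simp only [RCLike.star_def, conj_ofReal]
        ring

/-- Vectors whose Gram matrices are comparable are related by a contraction. -/
lemma exists_contraction_of_norm_sum_le {P E : Type*} [Fintype P] [NormedAddCommGroup E]
    [InnerProductSpace ℂ E] [FiniteDimensional ℂ E] {u w : P → E}
    (h : ∀ t : P → ℂ, ‖∑ p, t p • w p‖ ≤ ‖∑ p, t p • u p‖) :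
    ∃ L : E →ₗ[ℂ] E, (∀ v, ‖L v‖ ≤ ‖v‖) ∧ ∀ p, L (u p) = w p := by
  classical
  set T := Fintype.linearCombination ℂ u with hT
  set S := Fintype.linearCombination ℂ w with hS
  have hST : ∀ t, ‖S t‖ ≤ ‖T t‖ := fun t => by
    simpa [hT, hS, Fintype.linearCombination_apply] using h t
  obtain ⟨R, hR⟩ := T.rangeRestrict.exists_rightInverse_of_surjective T.range_rangeRestrict
  have hTR : ∀ y : LinearMap.range T, T (R y) = y := fun y =>
    congrArg Subtype.val (LinearMap.congr_fun hR y)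
  refine ⟨S ∘ₗ R ∘ₗ ((LinearMap.range T).orthogonalProjectionOnto : E →ₗ[ℂ] LinearMap.range T),
    fun v => ?_, fun p => ?_⟩
  · refine (hST _).trans ?_
    rw [LinearMap.comp_apply, hTR]
    exact Submodule.norm_orthogonalProjectionOnto_apply_le _ v
  · have hu : T (Pi.single p 1) = u p := by simp [hT]
    have hw : S (Pi.single p 1) = w p := by simp [hS]
    have hmem : u p ∈ LinearMap.range T := ⟨_, hu⟩
    have hproj : (LinearMap.range T).orthogonalProjectionOnto (u p) = ⟨u p, hmem⟩ :=
      (LinearMap.range T).orthogonalProjectionOnto_mem_subspace_eq_self ⟨u p, hmem⟩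
    have h0 := hST (R ⟨u p, hmem⟩ - Pi.single p 1)
    rw [map_sub T, hTR, hu, sub_self, norm_zero, norm_le_zero_iff, map_sub, sub_eq_zero, hw] at h0
    simpa [hproj] using h0

lemma exists_contraction_matrix {P κ : Type*} [Fintype P] [Fintype κ] [DecidableEq κ]
    {u w : P → κ → ℂ}
    (h : ∀ t : P → ℂ, ∑ i, ‖∑ p, t p * w p i‖ ^ 2 ≤ ∑ i, ‖∑ p, t p * u p i‖ ^ 2) :
    ∃ L : Matrix κ κ ℂ, (∀ v, ∑ i, ‖(L *ᵥ v) i‖ ^ 2 ≤ ∑ i, ‖v i‖ ^ 2) ∧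
      ∀ p, L *ᵥ u p = w p := by
  obtain ⟨L, hL, hLu⟩ := exists_contraction_of_norm_sum_le
    (E := EuclideanSpace ℂ κ) (u := fun p => WithLp.toLp 2 (u p))
    (w := fun p => WithLp.toLp 2 (w p)) fun t => by
      rw [← sq_le_sq₀ (norm_nonneg _) (norm_nonneg _), EuclideanSpace.norm_sq_eq,
        EuclideanSpace.norm_sq_eq]
      simpa using h t
  set e := WithLp.linearEquiv 2 ℂ (κ → ℂ) with he
  have key : ∀ v, LinearMap.toMatrix' (e.toLinearMap ∘ₗ L ∘ₗ e.symm.toLinearMap) *ᵥ v =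
      WithLp.ofLp (L (WithLp.toLp 2 v)) := fun v => by
    rw [LinearMap.toMatrix'_mulVec]
    rfl
  refine ⟨LinearMap.toMatrix' (e.toLinearMap ∘ₗ L ∘ₗ e.symm.toLinearMap), fun v => ?_,
    fun p => ?_⟩
  · have := (sq_le_sq₀ (norm_nonneg _) (norm_nonneg _)).2 (hL (WithLp.toLp 2 v))
    rw [EuclideanSpace.norm_sq_eq, EuclideanSpace.norm_sq_eq] at this
    rw [key]
    exact this
  · rw [key, hLu]

end Realization

/-- The transfer function `A + l B (1 - l D)⁻¹ C` of a block operator matrix. -/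
def transferFunction {m : Type*} [Fintype m] [DecidableEq m]
    (L : Matrix (Fin 2 ⊕ m) (Fin 2 ⊕ m) ℂ) (l : ℂ) : Matrix (Fin 2) (Fin 2) ℂ :=
  L.toBlocks₁₁ + l • (L.toBlocks₁₂ * (1 - l • L.toBlocks₂₂)⁻¹ * L.toBlocks₂₁)

section TransferFunction

variable {m : Type*} [Fintype m] [DecidableEq m] {L : Matrix (Fin 2 ⊕ m) (Fin 2 ⊕ m) ℂ}

lemma det_one_sub_smul_toBlocks₂₂_ne_zero
    (hL : ∀ v, ∑ i, ‖(L *ᵥ v) i‖ ^ 2 ≤ ∑ i, ‖v i‖ ^ 2) {l : ℂ} (hl : l ∈ uDisc) :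
    (1 - l • L.toBlocks₂₂).det ≠ 0 := by
  intro h0
  obtain ⟨v, hv, hv0⟩ := exists_mulVec_eq_zero_iff.2 h0
  have hl1 : ‖l‖ < 1 := by simpa [uDisc] using hl
  have hv' : v = l • (L.toBlocks₂₂ *ᵥ v) := by
    rw [sub_mulVec, one_mulVec, smul_mulVec, sub_eq_zero] at hv0
    exact hv0
  have h1 := hL (Sum.elim 0 v)
  rw [← fromBlocks_toBlocks L, fromBlocks_mulVec] at h1
  simp only [Fintype.sum_sum_type, Sum.elim_inl, Sum.elim_inr, Function.comp_def] at h1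
  simp only [Pi.add_apply, Pi.zero_apply, norm_zero] at h1
  have h2 : ∑ i, ‖v i‖ ^ 2 = ‖l‖ ^ 2 * ∑ i, ‖(L.toBlocks₂₂ *ᵥ v) i‖ ^ 2 := by
    conv_lhs => rw [hv']
    simp [Finset.mul_sum, mul_pow]
  have h3 : 0 ≤ ∑ i, ‖(L.toBlocks₂₂ *ᵥ v) i‖ ^ 2 := Finset.sum_nonneg fun i _ => sq_nonneg _
  have h4 : ∑ i, ‖(L.toBlocks₂₂ *ᵥ v) i‖ ^ 2 ≤ ∑ i, ‖v i‖ ^ 2 := by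
    refine le_trans ?_ (h1.trans (by simp))
    refine (le_add_of_nonneg_left (Finset.sum_nonneg fun i _ => sq_nonneg _)).trans_eq' ?_
    refine Finset.sum_congr rfl fun i _ => ?_
    simp [mulVec, dotProduct]
  have h5 : ∑ i, ‖v i‖ ^ 2 = 0 := by
    have h6 := Finset.sum_nonneg fun i (_ : i ∈ Finset.univ) => sq_nonneg ‖v i‖
    have h7 : ‖l‖ ^ 2 < 1 := by nlinarith [norm_nonneg l]
    nlinarith
  refine hv (funext fun i => ?_)
  have := (Finset.sum_eq_zero_iff_of_nonneg fun i _ => sq_nonneg ‖v i‖).1 h5 i (Finset.mem_univ i)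
  simpa using this

lemma mulVec_elim_transferFunction {l : ℂ} (hd : (1 - l • L.toBlocks₂₂).det ≠ 0) (v : Fin 2 → ℂ) :
    L *ᵥ Sum.elim v (l • ((1 - l • L.toBlocks₂₂)⁻¹ *ᵥ (L.toBlocks₂₁ *ᵥ v))) =
      Sum.elim (transferFunction L l *ᵥ v)
        ((1 - l • L.toBlocks₂₂)⁻¹ *ᵥ (L.toBlocks₂₁ *ᵥ v)) := by
  set y := (1 - l • L.toBlocks₂₂)⁻¹ *ᵥ (L.toBlocks₂₁ *ᵥ v) with hy
  have hy' : y = L.toBlocks₂₁ *ᵥ v + L.toBlocks₂₂ *ᵥ (l • y) := by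
    have : (1 - l • L.toBlocks₂₂) *ᵥ y = L.toBlocks₂₁ *ᵥ v := by
      rw [hy, mulVec_mulVec, mul_nonsing_inv _ (isUnit_iff_ne_zero.2 hd), one_mulVec]
    rw [sub_mulVec, one_mulVec, smul_mulVec, sub_eq_iff_eq_add] at this
    rwa [mulVec_smul]
  conv_lhs => rw [← fromBlocks_toBlocks L]
  rw [fromBlocks_mulVec]
  simp only [Function.comp_def, Sum.elim_inl, Sum.elim_inr]
  rw [← hy']
  congr 1
  rw [transferFunction, add_mulVec, smul_mulVec, ← mulVec_mulVec, ← mulVec_mulVec, ← hy,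
    mulVec_smul]

lemma transferFunction_contraction
    (hL : ∀ v, ∑ i, ‖(L *ᵥ v) i‖ ^ 2 ≤ ∑ i, ‖v i‖ ^ 2) {l : ℂ} (hl : l ∈ uDisc)
    (v : Fin 2 → ℂ) : ∑ i, ‖(transferFunction L l *ᵥ v) i‖ ^ 2 ≤ ∑ i, ‖v i‖ ^ 2 := by
  have h := hL (Sum.elim v (l • ((1 - l • L.toBlocks₂₂)⁻¹ *ᵥ (L.toBlocks₂₁ *ᵥ v))))
  rw [mulVec_elim_transferFunction (det_one_sub_smul_toBlocks₂₂_ne_zero hL hl)] at h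
  simp only [Fintype.sum_sum_type, Sum.elim_inl, Sum.elim_inr, Pi.smul_apply, smul_eq_mul,
    norm_mul, mul_pow, ← Finset.mul_sum] at h
  have hl1 : ‖l‖ < 1 := by simpa [uDisc] using hl
  have h1 := Finset.sum_nonneg fun i (_ : i ∈ Finset.univ) =>
    sq_nonneg ‖((1 - l • L.toBlocks₂₂)⁻¹ *ᵥ (L.toBlocks₂₁ *ᵥ v)) i‖
  have h2 : ‖l‖ ^ 2 ≤ 1 := by nlinarith [norm_nonneg l]
  linarith [mul_le_mul_of_nonneg_right h2 h1]

lemma transferFunction_mulVec_of_mulVec_elim {l : ℂ} (hd : (1 - l • L.toBlocks₂₂).det ≠ 0)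
    {v w : Fin 2 → ℂ} {y : m → ℂ} (h : L *ᵥ Sum.elim v (l • y) = Sum.elim w y) :
    transferFunction L l *ᵥ v = w := by
  rw [← fromBlocks_toBlocks L, fromBlocks_mulVec, Sum.elim_eq_iff] at h
  simp only [Function.comp_def, Sum.elim_inl, Sum.elim_inr] at h
  obtain ⟨h1, h2⟩ := h
  have hy : y = (1 - l • L.toBlocks₂₂)⁻¹ *ᵥ (L.toBlocks₂₁ *ᵥ v) := by
    have : L.toBlocks₂₁ *ᵥ v = (1 - l • L.toBlocks₂₂) *ᵥ y := by
      rw [sub_mulVec, one_mulVec, smul_mulVec, eq_sub_iff_add_eq, ← mulVec_smul, h2]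
    rw [this, mulVec_mulVec, nonsing_inv_mul _ (isUnit_iff_ne_zero.2 hd), one_mulVec]
  rw [transferFunction, add_mulVec, smul_mulVec, ← mulVec_mulVec, ← mulVec_mulVec, ← hy,
    ← mulVec_smul, h1]

end TransferFunction

section RationalOnDisc

lemma IsRationalOnDisc.polynomial (p : Polynomial ℂ) : IsRationalOnDisc fun z => p.eval z :=
  ⟨p, 1, by simp, by simp⟩

lemma IsRationalOnDisc.add {f g : ℂ → ℂ} (hf : IsRationalOnDisc f) (hg : IsRationalOnDisc g) :
    IsRationalOnDisc fun z => f z + g z := by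
  obtain ⟨p, q, hq, hf⟩ := hf
  obtain ⟨p', q', hq', hg⟩ := hg
  refine ⟨p * q' + q * p', q * q', fun z hz => ?_, fun z hz => ?_⟩
  · simpa using ⟨hq z hz, hq' z hz⟩
  · dsimp only
    rw [hf z hz, hg z hz, div_add_div _ _ (hq z hz) (hq' z hz)]
    simp

lemma IsRationalOnDisc.mul {f g : ℂ → ℂ} (hf : IsRationalOnDisc f) (hg : IsRationalOnDisc g) :
    IsRationalOnDisc fun z => f z * g z := by
  obtain ⟨p, q, hq, hf⟩ := hf
  obtain ⟨p', q', hq', hg⟩ := hg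
  refine ⟨p * p', q * q', fun z hz => ?_, fun z hz => ?_⟩
  · simpa using ⟨hq z hz, hq' z hz⟩
  · dsimp only
    rw [hf z hz, hg z hz, div_mul_div_comm]
    simp

lemma IsRationalOnDisc.const (c : ℂ) : IsRationalOnDisc fun _ => c :=
  ⟨.C c, 1, by simp, by simp⟩

lemma IsRationalOnDisc.sub {f g : ℂ → ℂ} (hf : IsRationalOnDisc f) (hg : IsRationalOnDisc g) :
    IsRationalOnDisc fun z => f z - g z := by
  simpa [sub_eq_add_neg] using hf.add ((IsRationalOnDisc.const (-1)).mul hg)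

lemma IsRationalOnDisc.sum {ι : Type*} (s : Finset ι) {f : ι → ℂ → ℂ}
    (hf : ∀ i, IsRationalOnDisc (f i)) : IsRationalOnDisc fun z => ∑ i ∈ s, f i z := by
  classical
  induction s using Finset.induction_on with
  | empty => simpa using IsRationalOnDisc.const 0
  | insert i s hi ih => simpa [Finset.sum_insert hi] using (hf i).add ih

lemma IsRationalOnDisc.analyticOnNhd {f : ℂ → ℂ} (hf : IsRationalOnDisc f) :
    AnalyticOnNhd ℂ f uDisc := by
  obtain ⟨p, q, hq, hf⟩ := hf
  have hd : DifferentiableOn ℂ (fun z => p.eval z / q.eval z) uDisc := fun z hz =>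
    (p.differentiableAt.fun_div q.differentiableAt (hq z hz)).differentiableWithinAt
  exact (hd.congr hf).analyticOnNhd isOpen_ball

variable {m : Type*} [Fintype m] [DecidableEq m]

lemma isRationalOnDisc_inv_one_sub_smul {D : Matrix m m ℂ}
    (hD : ∀ z ∈ uDisc, (1 - z • D).det ≠ 0) (s t : m) :
    IsRationalOnDisc fun z => ((1 - z • D)⁻¹) s t := by
  set P : Matrix m m (Polynomial ℂ) := 1 - (Polynomial.X : Polynomial ℂ) • D.map Polynomial.C
    with hP
  have hPe : ∀ z, (Polynomial.evalRingHom z).mapMatrix P = 1 - z • D := fun z => by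
    rw [hP, map_sub, map_one]
    congr 1
    ext i j
    simp
    ring
  have hdet : ∀ z, P.det.eval z = (1 - z • D).det := fun z => by
    rw [← hPe, ← RingHom.map_det]
    rfl
  have hadj : ∀ z, (P.adjugate s t).eval z = (1 - z • D).adjugate s t := fun z => by
    rw [← hPe, ← RingHom.map_adjugate]
    rfl
  refine ⟨P.adjugate s t, P.det, fun z hz => ?_, fun z hz => ?_⟩
  · rw [hdet]
    exact hD z hz
  · dsimp only
    rw [hdet, hadj, Matrix.inv_def, Ring.inverse_eq_inv', Matrix.smul_apply, smul_eq_mul, div_eq_inv_mul]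

lemma isRationalOnDisc_transferFunction {L : Matrix (Fin 2 ⊕ m) (Fin 2 ⊕ m) ℂ}
    (hL : ∀ v, ∑ i, ‖(L *ᵥ v) i‖ ^ 2 ≤ ∑ i, ‖v i‖ ^ 2) (s t : Fin 2) :
    IsRationalOnDisc fun z => transferFunction L z s t := by
  simp only [transferFunction, Matrix.add_apply, Matrix.smul_apply, smul_eq_mul, mul_apply]
  refine (IsRationalOnDisc.const _).add (IsRationalOnDisc.mul ?_ (IsRationalOnDisc.sum _ fun i =>
    (IsRationalOnDisc.sum _ fun j => (IsRationalOnDisc.const _).mul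
      (isRationalOnDisc_inv_one_sub_smul ?_ _ _)).mul (IsRationalOnDisc.const _)))
  · simpa using IsRationalOnDisc.polynomial .X
  · exact fun z hz => det_one_sub_smul_toBlocks₂₂_ne_zero hL hz

end RationalOnDisc

section Interpolation

lemma eq_of_forall_mul_one_sub_eq {x₁ x₂ x₃ y₁ y₂ y₃ : ℂ} (hx : x₁ * x₂ ≠ x₃) {zs : Fin 3 → ℂ}
    (hzs : Function.Injective zs)
    (h : ∀ k, (x₁ - x₃ * zs k) * (1 - y₂ * zs k) = (y₁ - y₃ * zs k) * (1 - x₂ * zs k)) :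
    y₁ = x₁ ∧ y₂ = x₂ ∧ y₃ = x₃ := by
  have h01 : zs 0 - zs 1 ≠ 0 := sub_ne_zero.2 (hzs.ne (by decide))
  have h02 : zs 0 - zs 2 ≠ 0 := sub_ne_zero.2 (hzs.ne (by decide))
  have h12 : zs 1 - zs 2 ≠ 0 := sub_ne_zero.2 (hzs.ne (by decide))
  have e0 := h 0
  have e1 := h 1
  have e2 := h 2
  generalize zs 0 = a at *
  generalize zs 1 = b at *
  generalize zs 2 = c at *
  have d1 : (y₃ + y₁ * x₂ - x₃ - x₁ * y₂) + (x₃ * y₂ - y₃ * x₂) * (a + b) = 0 := by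
    refine (mul_eq_zero.1 (?_ : (a - b) * _ = 0)).resolve_left h01
    linear_combination e0 - e1
  have d2 : (y₃ + y₁ * x₂ - x₃ - x₁ * y₂) + (x₃ * y₂ - y₃ * x₂) * (a + c) = 0 := by
    refine (mul_eq_zero.1 (?_ : (a - c) * _ = 0)).resolve_left h02
    linear_combination e0 - e2
  have q : x₃ * y₂ - y₃ * x₂ = 0 := by
    refine (mul_eq_zero.1 (?_ : (b - c) * _ = 0)).resolve_left h12
    linear_combination d1 - d2
  have r : y₃ + y₁ * x₂ - x₃ - x₁ * y₂ = 0 := by linear_combination d1 - (a + b) * q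
  have p : y₁ = x₁ := by linear_combination a * r + a ^ 2 * q - e0
  have s : y₂ = x₂ := by
    refine sub_eq_zero.1 ((mul_eq_zero.1 (?_ : (x₁ * x₂ - x₃) * _ = 0)).resolve_left
      (sub_ne_zero.2 hx))
    linear_combination -x₂ * r - q + x₂ ^ 2 * p
  exact ⟨p, s, by linear_combination r - x₂ * p + x₁ * s⟩

lemma ofReal_sum_norm_sq_sum {P κ : Type*} [Fintype P] [Fintype κ] (t : P → ℂ) (w : P → κ → ℂ) :
    ((∑ i, ‖∑ p, t p * w p i‖ ^ 2 : ℝ) : ℂ) =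
      ∑ p, ∑ q, star (t p) * ((∑ i, star (w p i) * w q i) * t q) := by
  have h (i : κ) : ((‖∑ p, t p * w p i‖ ^ 2 : ℝ) : ℂ) =
      ∑ p, ∑ q, star (t p) * (star (w p i) * w q i * t q) := by
    rw [Complex.ofReal_pow, ← Complex.conj_mul', map_sum, Finset.sum_mul_sum]
    refine Finset.sum_congr rfl fun p _ => Finset.sum_congr rfl fun q _ => ?_
    simp only [map_mul, RCLike.star_def]
    ring
  rw [Complex.ofReal_sum]
  simp only [h, Finset.sum_mul, Finset.mul_sum]
  rw [Finset.sum_comm]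
  exact Finset.sum_congr rfl fun p _ => Finset.sum_comm

lemma exists_transferFunction_of_posSemidef {n : ℕ} {lam x₁ x₂ x₃ : Fin n → ℂ}
    (hlam : ∀ j, lam j ∈ uDisc) {zs : Fin 3 → ℂ}
    {N M : Matrix (Fin n × Fin 3) (Fin n × Fin 3) ℂ}
    (hN : N.PosSemidef) (hNr : N.rank ≤ 1) (hM : M.PosSemidef)
    (h : (Matrix.of fun p q : Fin n × Fin 3 =>
            1 - star ((zs p.2 * x₃ p.1 - x₁ p.1) / (x₂ p.1 * zs p.2 - 1)) *
                  ((zs q.2 * x₃ q.1 - x₁ q.1) / (x₂ q.1 * zs q.2 - 1)) -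
              (1 - star (zs p.2) * zs q.2) * N p q -
                (1 - star (lam p.1) * lam q.1) * M p q).PosSemidef) :
    ∃ L : Matrix (Fin 2 ⊕ (Fin n × Fin 3)) (Fin 2 ⊕ (Fin n × Fin 3)) ℂ,
      (∀ v, ∑ i, ‖(L *ᵥ v) i‖ ^ 2 ≤ ∑ i, ‖v i‖ ^ 2) ∧
      ∀ j k, ∃ γ : ℂ, transferFunction L (lam j) *ᵥ ![1, zs k * γ] =
        ![(zs k * x₃ j - x₁ j) / (x₂ j * zs k - 1), γ] := by
  obtain ⟨γ, hγ⟩ := exists_eq_star_mul_of_rank_le_one hN hNr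
  obtain ⟨B, hB⟩ := exists_eq_conjTranspose_mul_self hM
  let Ψ : Fin n × Fin 3 → ℂ := fun p => (zs p.2 * x₃ p.1 - x₁ p.1) / (x₂ p.1 * zs p.2 - 1)
  have hΨ (p) : (zs p.2 * x₃ p.1 - x₁ p.1) / (x₂ p.1 * zs p.2 - 1) = Ψ p := rfl
  obtain ⟨L, hL, hLu⟩ := exists_contraction_matrix
    (u := fun p : Fin n × Fin 3 =>
      (Sum.elim ![1, zs p.2 * γ p] (lam p.1 • fun i => B i p) : Fin 2 ⊕ (Fin n × Fin 3) → ℂ))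
    (w := fun p => Sum.elim ![Ψ p, γ p] fun i => B i p) (fun t => by
      have h1 := h.dotProduct_mulVec_nonneg t
      rw [← Complex.real_le_real, ← sub_nonneg, ofReal_sum_norm_sq_sum, ofReal_sum_norm_sq_sum]
      convert h1 using 1
      simp only [dotProduct, mulVec, Pi.star_apply, Finset.mul_sum, ← Finset.sum_sub_distrib]
      refine Finset.sum_congr rfl fun p _ => Finset.sum_congr rfl fun q _ => ?_
      have hM' : M p q = ∑ i, star (B i p) * B i q := by
        simp [hB, mul_apply]
      have hM'' : ∑ i, star (lam p.1 * B i p) * (lam q.1 * B i q) =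
          star (lam p.1) * lam q.1 * M p q := by
        rw [hM', Finset.mul_sum]
        refine Finset.sum_congr rfl fun i _ => ?_
        rw [star_mul']
        ring
      simp only [Fintype.sum_sum_type, Fin.sum_univ_two, Sum.elim_inl, Sum.elim_inr, of_apply,
        cons_val_zero, cons_val_one, Pi.smul_apply, smul_eq_mul, hM'', ← hM', star_one, hγ, hΨ]
      simp only [star_mul']
      ring)
  refine ⟨L, hL, fun j k => ⟨γ (j, k), ?_⟩⟩
  exact transferFunction_mulVec_of_mulVec_elim
    (det_one_sub_smul_toBlocks₂₂_ne_zero hL (hlam j)) (hLu (j, k))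

lemma exists_rational_of_posSemidef {n : ℕ} {lam x₁ x₂ x₃ : Fin n → ℂ}
    (hlam : ∀ j, lam j ∈ uDisc) (hx : ∀ j, x₁ j * x₂ j ≠ x₃ j) {zs : Fin 3 → ℂ}
    (hinj : Function.Injective zs) (hzs : ∀ j k, x₂ j * zs k ≠ 1)
    {N M : Matrix (Fin n × Fin 3) (Fin n × Fin 3) ℂ}
    (hN : N.PosSemidef) (hNr : N.rank ≤ 1) (hM : M.PosSemidef)
    (h : (Matrix.of fun p q : Fin n × Fin 3 =>
            1 - star ((zs p.2 * x₃ p.1 - x₁ p.1) / (x₂ p.1 * zs p.2 - 1)) *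
                  ((zs q.2 * x₃ q.1 - x₁ q.1) / (x₂ q.1 * zs q.2 - 1)) -
              (1 - star (zs p.2) * zs q.2) * N p q -
                (1 - star (lam p.1) * lam q.1) * M p q).PosSemidef) :
    ∃ x : ℂ → ℂ × ℂ × ℂ,
      IsRationalOnDisc (fun l => (x l).1) ∧
      IsRationalOnDisc (fun l => (x l).2.1) ∧
      IsRationalOnDisc (fun l => (x l).2.2) ∧
      (∀ l ∈ uDisc, x l ∈ closedTetra) ∧
      ∀ j, x (lam j) = (x₁ j, x₂ j, x₃ j) := by
  obtain ⟨L, hL, hLx⟩ := exists_transferFunction_of_posSemidef hlam hN hNr hM h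
  have hr := isRationalOnDisc_transferFunction hL
  refine ⟨fun l => (transferFunction L l 0 0, transferFunction L l 1 1, (transferFunction L l).det),
    hr 0 0, hr 1 1, ?_,
    fun l hl => mem_closedTetra_of_contraction _ (transferFunction_contraction hL hl), fun j => ?_⟩
  · simp only [det_fin_two]
    exact ((hr 0 0).mul (hr 1 1)).sub ((hr 0 1).mul (hr 1 0))
  · obtain ⟨e1, e2, e3⟩ := eq_of_forall_mul_one_sub_eq (hx j) hinj
      (y₁ := transferFunction L (lam j) 0 0) (y₂ := transferFunction L (lam j) 1 1)
      (y₃ := (transferFunction L (lam j)).det) (fun k => by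
        obtain ⟨γ, hγ⟩ := hLx j k
        have h0 := congrFun hγ 0
        have h1 := congrFun hγ 1
        simp [mulVec, dotProduct, Fin.sum_univ_two] at h0 h1
        have hne : x₂ j * zs k - 1 ≠ 0 := sub_ne_zero.2 (hzs j k)
        rw [eq_div_iff hne] at h0
        rw [det_fin_two]
        generalize transferFunction L (lam j) 0 0 = A at *
        generalize transferFunction L (lam j) 0 1 = b at *
        generalize transferFunction L (lam j) 1 0 = c at *
        generalize transferFunction L (lam j) 1 1 = d at *
        linear_combination (1 - d * zs k) * h0 + b * zs k * (x₂ j * zs k - 1) * h1)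
    simp [e1, e2, e3]

end Interpolation

section Synthesis

lemma exists_analytic_ne_zero_interpolating {n : ℕ} {lam : Fin n → ℂ}
    (hinj : Function.Injective lam) {c : Fin n → ℂ} (hc : ∀ j, c j ≠ 0) :
    ∃ f : ℂ → ℂ, Differentiable ℂ f ∧ (∀ z, f z ≠ 0) ∧ ∀ j, f (lam j) = c j := by
  refine ⟨fun z => Complex.exp
    ((Lagrange.interpolate Finset.univ lam fun j => Complex.log (c j)).eval z), by fun_prop,
    fun z => Complex.exp_ne_zero _, fun j => ?_⟩
  simp only
  rw [Lagrange.eval_interpolate_at_node _ hinj.injOn (Finset.mem_univ j), Complex.exp_log (hc j)]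

lemma exists_analytic_synthesis {n : ℕ} {lam : Fin n → ℂ}
    (hinj : Function.Injective lam) {W : Fin n → Matrix (Fin 2) (Fin 2) ℂ}
    (hW : ∀ j, W j 0 0 * W j 1 1 ≠ (W j).det) {x : ℂ → ℂ × ℂ × ℂ}
    (h₁ : AnalyticOnNhd ℂ (fun l => (x l).1) uDisc)
    (h₂ : AnalyticOnNhd ℂ (fun l => (x l).2.1) uDisc)
    (h₃ : AnalyticOnNhd ℂ (fun l => (x l).2.2) uDisc)
    (hx : ∀ l ∈ uDisc, x l ∈ closedTetra)
    (hxW : ∀ j, x (lam j) = (W j 0 0, W j 1 1, (W j).det)) :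
    ∃ F : ℂ → Matrix (Fin 2) (Fin 2) ℂ,
      (∀ i j, AnalyticOnNhd ℂ (fun l => F l i j) uDisc) ∧
      (∀ j, F (lam j) = W j) ∧ ∀ l ∈ uDisc, muDiag (F l) ≤ 1 := by
  have hW' : ∀ j, W j 0 1 ≠ 0 := fun j h0 => hW j (by rw [det_fin_two, h0]; ring)
  obtain ⟨f, hf, hf0, hfW⟩ := exists_analytic_ne_zero_interpolating hinj hW'
  have hfa : AnalyticOnNhd ℂ f uDisc := hf.differentiableOn.analyticOnNhd isOpen_ball
  refine ⟨fun l => !![(x l).1, f l; ((x l).1 * (x l).2.1 - (x l).2.2) / f l, (x l).2.1],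
    fun i j => ?_, fun j => ?_, fun l hl => ?_⟩
  · fin_cases i <;> fin_cases j
    · exact h₁
    · exact hfa
    · exact ((h₁.mul h₂).sub h₃).div hfa fun l _ => hf0 l
    · exact h₂
  · have h10 : (W j 0 0 * W j 1 1 - (W j).det) / W j 0 1 = W j 1 0 := by
      rw [div_eq_iff (hW' j), det_fin_two]
      ring
    ext i k
    fin_cases i <;> fin_cases k <;> simp [hxW, hfW, h10]
  · rw [muDiag_le_one_iff, det_fin_two]
    have : (x l).1 * (x l).2.1 - f l * (((x l).1 * (x l).2.1 - (x l).2.2) / f l) = (x l).2.2 := by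
      rw [mul_div_cancel₀ _ (hf0 l)]
      ring
    simpa [this] using hx l hl

lemma exists_posSemidef_of_synthesis {n : ℕ} {lam : Fin n → ℂ} (hlam : ∀ j, lam j ∈ uDisc)
    {W : Fin n → Matrix (Fin 2) (Fin 2) ℂ} (hW : ∀ j, W j 0 0 * W j 1 1 ≠ (W j).det)
    {x₁ x₂ x₃ : Fin n → ℂ} (hx : ∀ j, x₁ j = W j 0 0 ∧ x₂ j = W j 1 1 ∧ x₃ j = (W j).det)
    {F : ℂ → Matrix (Fin 2) (Fin 2) ℂ}
    (hF : ∀ i j, AnalyticOnNhd ℂ (fun l => F l i j) uDisc)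
    (hFW : ∀ j, F (lam j) = W j) (hmu : ∀ l ∈ uDisc, muDiag (F l) ≤ 1)
    {zs : Fin 3 → ℂ} (hzs : ∀ k, zs k ∈ uDisc) :
    (∀ j k, x₂ j * zs k ≠ 1) ∧
      ∃ N M : Matrix (Fin n × Fin 3) (Fin n × Fin 3) ℂ,
        N.PosSemidef ∧ N.rank ≤ 1 ∧ M.PosSemidef ∧
        (Matrix.of fun p q : Fin n × Fin 3 =>
          1 - star ((zs p.2 * x₃ p.1 - x₁ p.1) / (x₂ p.1 * zs p.2 - 1)) *
                ((zs q.2 * x₃ q.1 - x₁ q.1) / (x₂ q.1 * zs q.2 - 1)) -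
            (1 - star (zs p.2) * zs q.2) * N p q -
              (1 - star (lam p.1) * lam q.1) * M p q).PosSemidef := by
  obtain rfl : x₁ = fun j => F (lam j) 0 0 := funext fun j => by rw [hFW, (hx j).1]
  obtain rfl : x₂ = fun j => F (lam j) 1 1 := funext fun j => by rw [hFW, (hx j).2.1]
  obtain rfl : x₃ = fun j => (F (lam j)).det := funext fun j => by rw [hFW, (hx j).2.2]
  have htet : ∀ l ∈ uDisc, (F l 0 0, F l 1 1, (F l).det) ∈ closedTetra := fun l hl =>
    (muDiag_le_one_iff _).1 (hmu l hl)
  have hdet : AnalyticOnNhd ℂ (fun l => (F l).det) uDisc := by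
    simp only [det_fin_two]
    exact ((hF 0 0).mul (hF 1 1)).sub ((hF 0 1).mul (hF 1 0))
  obtain ⟨a, b, hab, hker⟩ := exists_kernel_nonneg hlam (hF 0 0) (hF 1 1) hdet htet
    fun j => by
      rw [hFW]
      exact hW j
  have hle : ∀ j, ‖F (lam j) 1 1‖ ≤ 1 := fun j =>
    norm_snd_le_one_of_mem_closedTetra (htet _ (hlam j))
  exact ⟨fun j k => (sub_ne_zero.1 (one_sub_mul_ne_zero (hle j) (hzs k))).symm,
    exists_posSemidef_of_kernel_nonneg hlam hle hab hker hzs⟩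

end Synthesis

/-- Theorem 1.1: solvability criterion for the μ_Diag-synthesis problem. -/
theorem muDiag_synthesis_criterion (n : ℕ)
    (lam : Fin n → ℂ) (hlam : ∀ j, lam j ∈ uDisc) (hdist : Function.Injective lam)
    (W : Fin n → Matrix (Fin 2) (Fin 2) ℂ)
    (hW : ∀ j, W j 0 0 * W j 1 1 ≠ (W j).det)
    (x1 x2 x3 : Fin n → ℂ)
    (hx : ∀ j, x1 j = W j 0 0 ∧ x2 j = W j 1 1 ∧ x3 j = (W j).det) :
    -- (1) ↔ (2)
    (((∃ F : ℂ → Matrix (Fin 2) (Fin 2) ℂ,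
        (∀ i j, AnalyticOnNhd ℂ (fun l => F l i j) uDisc) ∧
        (∀ j, F (lam j) = W j) ∧
        (∀ l ∈ uDisc, muDiag (F l) ≤ 1)) ↔
      (∃ x : ℂ → ℂ × ℂ × ℂ,
        IsRationalOnDisc (fun l => (x l).1) ∧
        IsRationalOnDisc (fun l => (x l).2.1) ∧
        IsRationalOnDisc (fun l => (x l).2.2) ∧
        (∀ l ∈ uDisc, x l ∈ closedTetra) ∧
        ∀ j, x (lam j) = (x1 j, x2 j, x3 j))) ∧
    -- (1) ↔ (3)
    ((∃ F : ℂ → Matrix (Fin 2) (Fin 2) ℂ,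
        (∀ i j, AnalyticOnNhd ℂ (fun l => F l i j) uDisc) ∧
        (∀ j, F (lam j) = W j) ∧
        (∀ l ∈ uDisc, muDiag (F l) ≤ 1)) ↔
      (∃ zs : Fin 3 → ℂ, (∀ k, zs k ∈ uDisc) ∧ Function.Injective zs ∧
        (∀ j k, x2 j * zs k ≠ 1) ∧
        ∃ N M : Matrix (Fin n × Fin 3) (Fin n × Fin 3) ℂ,
          N.PosSemidef ∧ N.rank ≤ 1 ∧ M.PosSemidef ∧
          (Matrix.of fun p q : Fin n × Fin 3 =>
            1 - star ((zs p.2 * x3 p.1 - x1 p.1) / (x2 p.1 * zs p.2 - 1)) *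
                  ((zs q.2 * x3 q.1 - x1 q.1) / (x2 q.1 * zs q.2 - 1)) -
              (1 - star (zs p.2) * zs q.2) * N p q -
                (1 - star (lam p.1) * lam q.1) * M p q).PosSemidef))) := by

  have h21 : (∃ x : ℂ → ℂ × ℂ × ℂ, IsRationalOnDisc (fun l => (x l).1) ∧
      IsRationalOnDisc (fun l => (x l).2.1) ∧ IsRationalOnDisc (fun l => (x l).2.2) ∧
      (∀ l ∈ uDisc, x l ∈ closedTetra) ∧ ∀ j, x (lam j) = (x1 j, x2 j, x3 j)) →
      ∃ F : ℂ → Matrix (Fin 2) (Fin 2) ℂ,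
        (∀ i j, AnalyticOnNhd ℂ (fun l => F l i j) uDisc) ∧
        (∀ j, F (lam j) = W j) ∧ ∀ l ∈ uDisc, muDiag (F l) ≤ 1 := by
    rintro ⟨x, hr₁, hr₂, hr₃, htet, hint⟩
    exact exists_analytic_synthesis hdist hW hr₁.analyticOnNhd hr₂.analyticOnNhd
      hr₃.analyticOnNhd htet fun j => by rw [hint, (hx j).1, (hx j).2.1, (hx j).2.2]
  have hne : ∀ j, x1 j * x2 j ≠ x3 j := fun j => by
    rw [(hx j).1, (hx j).2.1, (hx j).2.2]
    exact hW j
  have hzs : ∀ k, (![0, 1 / 2, -1 / 2] : Fin 3 → ℂ) k ∈ uDisc := fun k => by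
    fin_cases k <;> norm_num [uDisc]
  have hinj : Function.Injective (![0, 1 / 2, -1 / 2] : Fin 3 → ℂ) := fun i j => by
    fin_cases i <;> fin_cases j <;> norm_num
  refine ⟨⟨?_, h21⟩, ?_, fun h => h21 ?_⟩
  · rintro ⟨F, hF, hFW, hmu⟩
    obtain ⟨hz, N, M, hN, hNr, hM, hR⟩ := exists_posSemidef_of_synthesis hlam hW hx hF hFW hmu hzs
    exact exists_rational_of_posSemidef hlam hne hinj hz hN hNr hM hR
  · rintro ⟨F, hF, hFW, hmu⟩
    exact ⟨_, hzs, hinj, exists_posSemidef_of_synthesis hlam hW hx hF hFW hmu hzs⟩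
  · obtain ⟨zs, -, hinj', hz, N, M, hN, hNr, hM, hR⟩ := h
    exact exists_rational_of_posSemidef hlam hne hinj' hz hN hNr hM hR

end
end

section
/- Let F = [F_{ij}] ∈ 𝒮^{2×2} and define x = (x₁, x₂, x₃) : 𝔻 → ℂ³ by x₁ = F₁₁, x₂ = F₂₂, x₃ = det F. Then for all λ ∈ 𝔻 and all z ∈ ℂ with 1 − F₂₂(λ)z ≠ 0, one has ℱ_{F(λ)}(z) = Ψ(z, x(λ)), and for all μ, λ ∈ 𝔻 and all w, z ∈ ℂ with 1 − F₂₂(μ)w ≠ 0 and 1 − F₂₂(λ)z ≠ 0, 1 − conj(Ψ(w, x(μ)))·Ψ(z, x(λ)) = (1 − w̄z)·conj(γ(μ,w))·γ(λ,z) + η(μ,w)*·(I − F(μ)*F(λ))·η(λ,z). -/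
open Complex Matrix Metric
open scoped ComplexOrder

noncomputable section

/-- The linear fractional transformation ℱ_A(z) = a₁₁ + a₁₂ z (1 − a₂₂ z)⁻¹ a₂₁. -/
def lft (A : Matrix (Fin 2) (Fin 2) ℂ) (z : ℂ) : ℂ :=
  A 0 0 + A 0 1 * z * (1 - A 1 1 * z)⁻¹ * A 1 0

/-- Ψ(z,x) = (x₃z − x₁)/(x₂z − 1). -/
def Psi (z : ℂ) (x : ℂ × ℂ × ℂ) : ℂ := (x.2.2 * z - x.1) / (x.2.1 * z - 1)

/-- The values of the linear fractional transformation and of `γ` solve `F(λ) η = (ℱ, γ)ᵀ`. -/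
theorem mulVec_eta (F : ℂ → Matrix (Fin 2) (Fin 2) ℂ) (l z : ℂ) (h : 1 - F l 1 1 * z ≠ 0) :
    F l *ᵥ eta F l z = ![lft (F l) z, gam F l z] := by
  have hg : F l 1 0 + F l 1 1 * (z * gam F l z) = gam F l z := by
    unfold gam
    linear_combination (-F l 1 0) * mul_inv_cancel₀ h
  ext i
  fin_cases i
  · simp [Matrix.mulVec, dotProduct, _root_.eta, lft, gam]
    ring
  · simpa [Matrix.mulVec, dotProduct, _root_.eta] using hg

/-- The linear fractional transformation in terms of the diagonal entries and determinant. -/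
theorem lft_eq_Psi (A : Matrix (Fin 2) (Fin 2) ℂ) (z : ℂ) (h : 1 - A 1 1 * z ≠ 0) :
    lft A z = Psi z (A 0 0, A 1 1, A.det) := by
  have h' : A 1 1 * z - 1 ≠ 0 := fun h0 => h (by linear_combination -h0)
  rw [lft, Psi, eq_div_iff h', Matrix.det_fin_two]
  linear_combination (-(A 0 1 * z * A 1 0)) * mul_inv_cancel₀ h

/-- Part of Theorem 7.1: for `F ∈ 𝒮^{2×2}` and `x = (F₁₁, F₂₂, det F)`, one has
`ℱ_{F(λ)}(z) = Ψ(z, x(λ))` and the realization identity for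
`1 − conj(Ψ(w,x(μ))) Ψ(z,x(λ))`. -/
theorem lft_eq_Psi_and_realization
    (F : ℂ → Matrix (Fin 2) (Fin 2) ℂ) (hF : Schur2x2 F)
    (x : ℂ → ℂ × ℂ × ℂ) (hx : ∀ l, x l = (F l 0 0, F l 1 1, (F l).det)) :
    (∀ lam ∈ uDisc, ∀ z : ℂ, 1 - F lam 1 1 * z ≠ 0 →
      lft (F lam) z = Psi z (x lam)) ∧
    (∀ μ ∈ uDisc, ∀ lam ∈ uDisc, ∀ w z : ℂ,
      1 - F μ 1 1 * w ≠ 0 → 1 - F lam 1 1 * z ≠ 0 →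
      1 - star (Psi w (x μ)) * Psi z (x lam) =
        (1 - star w * z) * star (gam F μ w) * gam F lam z +
          star (eta F μ w) ⬝ᵥ ((1 - (F μ)ᴴ * F lam) *ᵥ eta F lam z)) := by
  refine ⟨fun l _ z h => by rw [hx, lft_eq_Psi _ _ h], fun μ _ l _ w z hw hz => ?_⟩
  rw [hx, hx, ← lft_eq_Psi _ _ hw, ← lft_eq_Psi _ _ hz, Matrix.sub_mulVec, Matrix.one_mulVec,
    dotProduct_sub, ← Matrix.mulVec_mulVec, Matrix.dotProduct_mulVec, ← Matrix.star_mulVec,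
    mulVec_eta F μ w hw, mulVec_eta F l z hz]
  simp [dotProduct, _root_.eta]
  ring

end
end

section
/- Let x = (x₁, x₂, x₃) and y = (y₁, y₂, y₃) be elements of Hol(𝔻, Ē) such that Ψ(z, x(λ)) = Ψ(z, y(λ)) for all z, λ ∈ 𝔻. Then: (i) if x₁x₂ is not identically equal to x₃ on 𝔻, then x = y on 𝔻; (ii) if x₁x₂ = x₃ identically on 𝔻, then y = (x₁, y₂, x₁y₂) on 𝔻, i.e. y₁ = x₁ and y₃ = x₁y₂. -/
open Complex Metric

noncomputable section

/-- Hol(𝔻,Ē): analytic maps of the disc into the closed tetrablock. -/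
def HolDiscTetra (x : ℂ → ℂ × ℂ × ℂ) : Prop :=
  AnalyticOnNhd ℂ x uDisc ∧ ∀ l ∈ uDisc, x l ∈ closedTetra

/-- Relations between the coordinates of two points `x`, `y` of `Ē` for which `Ψ(·, x)` and
`Ψ(·, y)` agree on the disc. -/
lemma coeff_eq_of_Psi_eq {x y : ℂ × ℂ × ℂ} (hx : x ∈ closedTetra) (hy : y ∈ closedTetra)
    (h : ∀ z ∈ uDisc, Psi z x = Psi z y) :
    y.1 = x.1 ∧ y.2.2 = x.2.2 - x.1 * x.2.1 + x.1 * y.2.1 ∧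
      (x.1 * x.2.1 - x.2.2) * (y.2.1 - x.2.1) = 0 := by
  have h0 : (0 : ℂ) ∈ uDisc := by simp [uDisc]
  have denom_ne {u : ℂ × ℂ × ℂ} (hu : u ∈ closedTetra) {z : ℂ} (hz : z ∈ uDisc) :
      u.2.1 * z - 1 ≠ 0 := fun hzero => hu 0 h0 z hz (by linear_combination -hzero)
  have cross (z : ℂ) (hz : z ∈ uDisc) :
      (x.2.2 * z - x.1) * (y.2.1 * z - 1) = (y.2.2 * z - y.1) * (x.2.1 * z - 1) :=
    (div_eq_div_iff (denom_ne hx hz) (denom_ne hy hz)).mp (h z hz)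
  have e0 := cross 0 h0
  have e1 := cross (1 / 2) (by norm_num [uDisc])
  have e2 := cross (-1 / 2) (by norm_num [uDisc])
  have c0 : y.1 = x.1 := by linear_combination -e0
  have c1 : y.2.2 = x.2.2 - x.1 * x.2.1 + x.1 * y.2.1 := by
    linear_combination e1 - e2 - x.2.1 * c0
  have c2 : x.2.2 * y.2.1 = y.2.2 * x.2.1 := by
    linear_combination 2 * e1 + 2 * e2 - 4 * e0
  exact ⟨c0, c1, by linear_combination -c2 - x.2.1 * c1⟩

/-- Proposition 8.12: if `x, y ∈ Hol(𝔻,Ē)` satisfy `Ψ(z,x(λ)) = Ψ(z,y(λ))` on 𝔻²,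
then (i) if `x₁x₂` is not identically `x₃` on 𝔻 then `x = y` on 𝔻, and (ii) if
`x₁x₂ = x₃` on 𝔻 then `y₁ = x₁` and `y₃ = x₁ y₂` on 𝔻. -/
theorem Psi_determines_x (x y : ℂ → ℂ × ℂ × ℂ)
    (hx : HolDiscTetra x) (hy : HolDiscTetra y)
    (heq : ∀ z ∈ uDisc, ∀ lam ∈ uDisc, Psi z (x lam) = Psi z (y lam)) :
    ((¬ ∀ lam ∈ uDisc, (x lam).1 * (x lam).2.1 = (x lam).2.2) →
      ∀ lam ∈ uDisc, x lam = y lam) ∧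
    ((∀ lam ∈ uDisc, (x lam).1 * (x lam).2.1 = (x lam).2.2) →
      ∀ lam ∈ uDisc, (y lam).1 = (x lam).1 ∧ (y lam).2.2 = (x lam).1 * (y lam).2.1) := by
  have coeff (l : ℂ) (hl : l ∈ uDisc) :=
    coeff_eq_of_Psi_eq (hx.2 l hl) (hy.2 l hl) fun z hz => heq z hz l hl
  refine ⟨fun hne l hl => ?_, fun hprod l hl => ?_⟩
  · have ax1 : AnalyticOnNhd ℂ (fun l => (x l).1) uDisc :=
      fun l hl => analyticAt_fst.comp (hx.1 l hl)
    have ax := fun l hl => analyticAt_snd.comp (hx.1 l hl)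
    have ay := fun l hl => analyticAt_snd.comp (hy.1 l hl)
    have ax2 : AnalyticOnNhd ℂ (fun l => (x l).2.1) uDisc :=
      fun l hl => analyticAt_fst.comp (ax l hl)
    have ax3 : AnalyticOnNhd ℂ (fun l => (x l).2.2) uDisc :=
      fun l hl => analyticAt_snd.comp (ax l hl)
    have ay2 : AnalyticOnNhd ℂ (fun l => (y l).2.1) uDisc :=
      fun l hl => analyticAt_fst.comp (ay l hl)
    have hpre : IsPreconnected uDisc := (convex_ball (0 : ℂ) 1).isPreconnected
    rcases ((ax1.mul ax2).sub ax3).eq_zero_or_eq_zero_of_mul_eq_zero (ay2.sub ax2)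
      (fun l hl => (coeff l hl).2.2) hpre with h | h
    · exact absurd (fun l hl => sub_eq_zero.mp (h l hl)) hne
    · obtain ⟨c0, c1, -⟩ := coeff l hl
      have c2 : (y l).2.1 = (x l).2.1 := sub_eq_zero.mp (h l hl)
      refine Prod.ext c0.symm (Prod.ext c2.symm ?_)
      rw [c1, c2]
      ring
  · obtain ⟨c0, c1, -⟩ := coeff l hl
    exact ⟨c0, by linear_combination c1 - hprod l hl⟩

end
end
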